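/- Let C be an irreducible algebraic curve over a perfect field k, let j ≥ 1, and let f_1, …, f_j ∈ k(C) each be rational functions of degree n ≥ 1 (that is, [k(C) : k(f_i)] = n for each i). If the subfield k(f_1, …, f_j) generated by the f_i equals k(C), then the genus of C satisfies g(C) ≤ (n−1)². -/

import Mathlib

open IntermediateField Multiplicative

/-- `K` is (the function field of) an irreducible variety over `k`:
a finitely generated field extension of `k`. -/
def IsFunctionField (k K : Type) [Field k] [Field K] [Algebra k K] : Prop :=
  ∃ s : Finset K, IntermediateField.adjoin k (s : Set K) = ⊤

/-- The variety with function field `K` has dimension at most `d`, i.e. the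
transcendence degree of `K/k` is at most `d`. -/
def DimLE (k K : Type) [Field k] [Field K] [Algebra k K] (d : ℕ) : Prop :=
  ∃ s : Finset K, s.card ≤ d ∧ Algebra.IsAlgebraic (IntermediateField.adjoin k (s : Set K)) K

/-- `K` is the function field of an irreducible algebraic curve over `k`: a finitely
generated field extension of `k` of transcendence degree one. -/
def IsCurveField (k K : Type) [Field k] [Field K] [Algebra k K] : Prop :=
  IsFunctionField k K ∧ DimLE k K 1 ∧ ∃ x : K, Transcendental k x

/-- The rational function `f` on the curve with function field `K` has degree `n`,
i.e. the corresponding dominant rational map to `P¹` is generically `n`-to-1: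
`[K : k(f)] = n` (in particular this extension is finite). -/
def RatFnDegree (k K : Type) [Field k] [Field K] [Algebra k K] (f : K) (n : ℕ) : Prop :=
  FiniteDimensional (IntermediateField.adjoin k ({f} : Set K)) K ∧
    Module.finrank (IntermediateField.adjoin k ({f} : Set K)) K = n

section Genus

variable (k F : Type) [Field k] [Field F] [Algebra k F]

/-- A place of the (smooth projective model of the) curve with function field `F`
over `k`: a normalized discrete valuation of `F` that is trivial on `k`. -/
structure PlaceOf where
  v : Valuation F (WithZero (Multiplicative ℤ))
  surjective : Function.Surjective v
  trivialOnBase : ∀ c : k, c ≠ 0 → v (algebraMap k F c) = 1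

variable {k F}

/-- The degree `[κ(P) : k]` of the residue field of a place over `k`. -/
noncomputable def PlaceOf.degree (P : PlaceOf k F) : ℕ :=
  letI : Algebra k (IsLocalRing.ResidueField P.v.valuationSubring) :=
    ((IsLocalRing.residue (R := ↥P.v.valuationSubring)).comp
      ((algebraMap k F).codRestrict P.v.valuationSubring.toSubring (fun c => by
        rcases eq_or_ne c 0 with h | h
        · simp [h, Valuation.mem_valuationSubring_iff]
        · exact le_of_eq (P.trivialOnBase c h)))).toAlgebra
  Module.finrank k (IsLocalRing.ResidueField P.v.valuationSubring)

variable (k F)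

/-- The degree of a divisor (an element of the free abelian group on the places)
on the curve with function field `F`. -/
noncomputable def DivisorOf.deg (D : PlaceOf k F →₀ ℤ) : ℤ :=
  D.sum fun P n => n * (P.degree : ℤ)

/-- The Riemann–Roch space `L(D) = {f ∈ F : div(f) + D ≥ 0}` of a divisor `D`,
as a `k`-subspace of `F`. -/
noncomputable def RRSpace (D : PlaceOf k F →₀ ℤ) : Submodule k F where
  carrier := {f | ∀ P : PlaceOf k F, P.v f ≤ ((ofAdd (D P) : Multiplicative ℤ) :
    WithZero (Multiplicative ℤ))}
  add_mem' := fun hf hg P => le_trans (Valuation.map_add _ _ _) (max_le (hf P) (hg P))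
  zero_mem' := fun P => by simp
  smul_mem' := fun c f hf P => by
    rw [Algebra.smul_def, Valuation.map_mul]
    rcases eq_or_ne c 0 with h | h
    · simp [h]
    · rw [P.trivialOnBase c h, one_mul]
      exact hf P

/-- `ℓ(D) = dim_k L(D)`. -/
noncomputable def ell (D : PlaceOf k F →₀ ℤ) : ℕ :=
  Module.finrank k (RRSpace k F D)

/-- The genus of the (smooth projective model of the) curve with function field
`F` over `k`: the maximal value of `deg D + ℓ(0) - ℓ(D)` over all divisors `D`
(for `D = 0` this value is `0`, and by the Riemann–Roch theorem the maximum is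
attained, and equals the genus, once `deg D` is large enough). -/
noncomputable def genus : ℕ :=
  sSup {g : ℕ | ∃ D : PlaceOf k F →₀ ℤ,
    (g : ℤ) + ell k F D = DivisorOf.deg k F D + ell k F 0}

end Genus

open scoped IntermediateField.algebraAdjoinAdjoin in
/-- Linear independence over `k(u)` can be tested with coefficients in `k[u]`. -/
theorem linearIndependent_adjoin_simple_iff {k F : Type} [Field k] [Field F] [Algebra k F]
    {ι : Type} [Fintype ι] (u : F) (x : ι → F) :
    LinearIndependent k⟮u⟯ x ↔ ∀ p : ι → Polynomial k,
      ∑ i, Polynomial.aeval u (p i) * x i = 0 → ∀ i, Polynomial.aeval u (p i) = 0 := by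
  rw [← LinearIndependent.iff_fractionRing (Algebra.adjoin k {u}), Fintype.linearIndependent_iff]
  have hmem (p : Polynomial k) : Polynomial.aeval u p ∈ Algebra.adjoin k {u} := by
    rw [Algebra.adjoin_singleton_eq_range_aeval]; exact ⟨p, rfl⟩
  refine ⟨fun h p hp i => ?_, fun h c hc i => ?_⟩
  · have := h (fun i => ⟨_, hmem (p i)⟩) (by simpa [Algebra.smul_def] using hp) i
    simpa using congrArg Subtype.val this
  · have hc' (i : ι) : ∃ p : Polynomial k, Polynomial.aeval u p = (c i : F) := by
      have := (Algebra.adjoin_singleton_eq_range_aeval k u).le (c i).2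
      exact this
    choose p hp using hc'
    refine Subtype.ext ?_
    rw [← hp i]
    exact h p (by simpa [hp, Algebra.smul_def] using hc) i

theorem aeval_mem_of_mem {k F : Type} [Field k] [Field F] [Algebra k F] (O : Subalgebra k F)
    {u : F} (hu : u ∈ O) (p : Polynomial k) : Polynomial.aeval u p ∈ O :=
  Algebra.adjoin_le (Set.singleton_subset_iff.mpr hu)
    ((Algebra.adjoin_singleton_eq_range_aeval k u).ge ⟨p, rfl⟩)

/-- Elements of a `k`-algebra `O` that are linearly independent modulo `u O` are linearly
independent over `k(u)`. -/
theorem linearIndependent_adjoin_simple_of_mod {k F : Type} [Field k] [Field F] [Algebra k F]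
    {ι : Type} [Fintype ι] (O : Subalgebra k F) {u : F} (hu : Transcendental k u) (huO : u ∈ O)
    (x : ι → F) (hx : ∀ i, x i ∈ O)
    (h : ∀ c : ι → k, (∃ o ∈ O, ∑ i, c i • x i = u * o) → c = 0) :
    LinearIndependent k⟮u⟯ x := by
  have hu0 : u ≠ 0 := fun h0 => hu (h0 ▸ isAlgebraic_zero)
  have key (N : ℕ) : ∀ p : ι → Polynomial k, (∀ i, (p i).natDegree < N) →
      ∑ i, Polynomial.aeval u (p i) * x i = 0 → p = 0 := by
    induction N with
    | zero =>
      intro p hp _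
      funext i
      exact absurd (hp i) (by simp)
    | succ N ih =>
      intro p hp hs
      have hdec (i : ι) : Polynomial.aeval u (p i) =
          algebraMap k F ((p i).coeff 0) + u * Polynomial.aeval u (p i).divX := by
        conv_lhs => rw [← Polynomial.X_mul_divX_add (p i)]
        rw [map_add, map_mul, Polynomial.aeval_X, Polynomial.aeval_C, add_comm]
      have hs' : ∑ i, (p i).coeff 0 • x i =
          u * -(∑ i, Polynomial.aeval u (p i).divX * x i) := by
        rw [← sub_eq_zero, ← hs, mul_neg, sub_neg_eq_add, Finset.mul_sum, ← Finset.sum_add_distrib]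
        refine Finset.sum_congr rfl fun i _ => ?_
        rw [hdec, Algebra.smul_def]
        ring
      have h0 := h _ ⟨_, O.neg_mem (O.sum_mem fun i _ => O.mul_mem
        (aeval_mem_of_mem O huO _) (hx i)), hs'⟩
      have h0' (i : ι) : (p i).coeff 0 = 0 := congrFun h0 i
      have hq : (fun i => (p i).divX) = 0 := by
        by_cases hN : N = 0
        · funext i
          have := hp i
          rw [Polynomial.eq_C_of_natDegree_le_zero (p := p i) (by omega)]
          exact Polynomial.divX_C _
        refine ih _ (fun i => ?_) ?_
        · rw [Polynomial.natDegree_divX_eq_natDegree_tsub_one]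
          have := hp i
          omega
        · have : u * ∑ i, Polynomial.aeval u (p i).divX * x i = 0 := by
            rw [← neg_eq_zero, ← mul_neg, ← hs']
            simp [h0']
          exact (mul_eq_zero.mp this).resolve_left hu0
      funext i
      rw [← Polynomial.X_mul_divX_add (p i), h0' i, show (p i).divX = 0 from congrFun hq i]
      simp
  rw [linearIndependent_adjoin_simple_iff]
  intro p hp i
  have := key (Finset.univ.sup (fun i => (p i).natDegree) + 1) p
    (fun i => Nat.lt_succ_of_le (Finset.le_sup (f := fun i => (p i).natDegree)
      (Finset.mem_univ i))) hp
  simp [this]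

/-- If `F` is a function field of one variable which is finite over `k(f)`, then it is finite
over `k(u)` for every transcendental element `u`. -/
theorem finiteDimensional_adjoin_simple_of_transcendental {k F : Type} [Field k] [Field F]
    [Algebra k F] (hF : IsFunctionField k F) (f : F) [FiniteDimensional k⟮f⟯ F] {u : F}
    (hu : Transcendental k u) : FiniteDimensional k⟮u⟯ F := by
  have hf : Transcendental k f := by
    intro hf
    have := IntermediateField.isAlgebraic_adjoin_simple hf.isIntegral
    have := Algebra.IsAlgebraic.trans k k⟮f⟯ F
    exact hu (Algebra.IsAlgebraic.isAlgebraic u)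
  have hb : IsTranscendenceBasis k (fun _ : Unit => f) := by
    rw [isTranscendenceBasis_iff_algebraicIndependent_isAlgebraic]
    refine ⟨(algebraicIndependent_singleton_iff ()).mpr hf, ?_⟩
    have : Algebra.IsAlgebraic k⟮f⟯ F := inferInstance
    rw [Set.range_const]
    open scoped IntermediateField.algebraAdjoinAdjoin in
    exact (IsFractionRing.comap_isAlgebraic_iff (A := Algebra.adjoin k {f}) (K := k⟮f⟯)).mpr this
  have htr : Algebra.trdeg k F = 1 := by
    have := hb.lift_cardinalMk_eq_trdeg
    simpa using this.symm
  have hb' : IsTranscendenceBasis k (fun _ : Unit => u) :=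
    AlgebraicIndependent.isTranscendenceBasis_of_trdeg_le_of_finite
      ((algebraicIndependent_singleton_iff ()).mpr hu) (by simp [htr])
  have halg : Algebra.IsAlgebraic k⟮u⟯ F := by
    have := hb'.isAlgebraic_field
    rwa [Set.range_const] at this
  obtain ⟨s, hs⟩ := hF
  have hs' : IntermediateField.adjoin k⟮u⟯ (s : Set F) = ⊤ := by
    refine IntermediateField.restrictScalars_injective k ?_
    rw [IntermediateField.adjoin_adjoin_left, IntermediateField.restrictScalars_top, eq_top_iff,
      ← hs]
    exact IntermediateField.adjoin.mono _ _ _ Set.subset_union_right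
  have := IntermediateField.finiteDimensional_adjoin (K := k⟮u⟯) (S := (s : Set F))
    fun x _ => (Algebra.IsAlgebraic.isAlgebraic x).isIntegral
  rw [hs'] at this
  exact Module.Finite.equiv (IntermediateField.topEquiv (F := k⟮u⟯) (E := F)).toLinearEquiv

/-- If `F` is finite over `k(u)` and `O` is a `k`-subalgebra of `F` containing `u`, then any
quotient of `O / u O` is finite over `k`. -/
theorem finite_of_surjective_of_map_mul_eq_zero {k F Q : Type} [Field k] [Field F] [Algebra k F]
    [AddCommGroup Q] [Module k Q] (O : Subalgebra k F) {u : F} (hu : Transcendental k u)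
    (huO : u ∈ O) [FiniteDimensional k⟮u⟯ F] (φ : O →ₗ[k] Q) (hφ : Function.Surjective φ)
    (h0 : ∀ o, φ (⟨u, huO⟩ * o) = 0) : Module.Finite k Q := by
  rw [← Module.rank_lt_aleph0_iff]
  refine (rank_le (n := Module.finrank k⟮u⟯ F) fun s hs => ?_).trans_lt (Cardinal.natCast_lt_aleph0)
  choose g hg using hφ
  have hl : LinearIndependent k⟮u⟯ (fun i : s => (g i.1 : F)) := by
    refine linearIndependent_adjoin_simple_of_mod O hu huO _ (fun i => (g i.1).2) ?_
    rintro c ⟨o, ho, h⟩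
    rw [Fintype.linearIndependent_iff] at hs
    funext i
    refine hs c ?_ i
    have h' : ∑ i : s, c i • g i.1 = ⟨u, huO⟩ * ⟨o, ho⟩ := by
      refine Subtype.ext ?_
      simpa using h
    rw [← h0 ⟨o, ho⟩, ← h', map_sum]
    simp only [map_smul, hg]
  exact (Fintype.card_coe s).symm.trans_le hl.fintype_card_le_finrank

/-- A valuation subring containing the base field, as a subalgebra. -/
def ValuationSubring.subalgebraOfBase {k F : Type} [Field k] [Field F] [Algebra k F]
    (V : ValuationSubring F) (hV : ∀ c : k, algebraMap k F c ∈ V) : Subalgebra k F :=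
  { V.toSubring with algebraMap_mem' := hV }

theorem ValuationSubring.mem_of_isAlgebraic {k F : Type} [Field k] [Field F] [Algebra k F]
    (V : ValuationSubring F) (hV : ∀ c : k, algebraMap k F c ∈ V) {x : F} (hx : IsAlgebraic k x) :
    x ∈ V := by
  have h1 : IsIntegral V.toSubring x := by
    obtain ⟨p, hp, hpx⟩ := hx.isIntegral
    refine ⟨p.map ((algebraMap k F).codRestrict V.toSubring hV), hp.map _, ?_⟩
    rw [Polynomial.eval₂_map]
    exact hpx
  obtain ⟨y, hy⟩ := (IsIntegrallyClosed.isIntegral_iff (R := V) (K := F)).mp h1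
  rw [← hy]
  exact y.2

section Places

variable {k F : Type} [Field k] [Field F] [Algebra k F] (P : PlaceOf k F)

theorem PlaceOf.v_algebraMap_le (c : k) : P.v (algebraMap k F c) ≤ 1 := by
  rcases eq_or_ne c 0 with rfl | h
  · simp
  · exact (P.trivialOnBase c h).le

theorem PlaceOf.v_smul_le (c : k) (x : F) : P.v (c • x) ≤ P.v x := by
  rw [Algebra.smul_def, map_mul]
  exact mul_le_of_le_one_left' (P.v_algebraMap_le c)

theorem PlaceOf.v_le_one_of_isAlgebraic {x : F} (hx : IsAlgebraic k x) : P.v x ≤ 1 :=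
  P.v.valuationSubring.mem_of_isAlgebraic P.v_algebraMap_le hx

theorem PlaceOf.transcendental_of_lt_one {u : F} (hu : P.v u < 1) (hu0 : u ≠ 0) :
    Transcendental k u := by
  intro h
  have := P.v_le_one_of_isAlgebraic h.inv
  rw [map_inv₀] at this
  have h0 : P.v u ≠ 0 := (Valuation.ne_zero_iff _).mpr hu0
  have := (inv_le_one₀ (zero_lt_iff.mpr h0)).mp this
  exact absurd hu (not_lt.mpr this)

/-- The valuation ring of a place, as a subalgebra. -/
noncomputable def PlaceOf.integers : Subalgebra k F :=
  P.v.valuationSubring.subalgebraOfBase P.v_algebraMap_le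

theorem PlaceOf.mem_integers {x : F} : x ∈ P.integers ↔ P.v x ≤ 1 := Iff.rfl

theorem PlaceOf.exists_uniformizer : ∃ t : F, P.v t = WithZero.exp (-1) := P.surjective _

/-- The reduction map at a place, in coordinates. -/
theorem PlaceOf.exists_reduction {u : F} (hu : P.v u < 1) (hu0 : u ≠ 0)
    [FiniteDimensional k⟮u⟯ F] :
    0 < P.degree ∧ ∃ ρ : P.integers →ₗ[k] (Fin P.degree → k), Function.Surjective ρ ∧
      ∀ x, ρ x = 0 ↔ P.v (x : F) < 1 := by
  have htr := P.transcendental_of_lt_one hu hu0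
  have huO : u ∈ P.integers := P.mem_integers.mpr hu.le
  let _ : Algebra k (IsLocalRing.ResidueField P.v.valuationSubring) :=
    ((IsLocalRing.residue (R := ↥P.v.valuationSubring)).comp
      ((algebraMap k F).codRestrict P.v.valuationSubring.toSubring P.v_algebraMap_le)).toAlgebra
  have hd : P.degree = Module.finrank k (IsLocalRing.ResidueField P.v.valuationSubring) := rfl
  let r : P.integers →ₐ[k] IsLocalRing.ResidueField P.v.valuationSubring :=
    { (IsLocalRing.residue (R := ↥P.v.valuationSubring)).comp
        (RingHom.id P.v.valuationSubring : P.integers →+* P.v.valuationSubring) with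
      commutes' := fun c => rfl }
  have hr (x : P.integers) : r x = 0 ↔ P.v (x : F) < 1 := by
    change IsLocalRing.residue (R := ↥P.v.valuationSubring) ⟨x.1, x.2⟩ = 0 ↔ _
    rw [IsLocalRing.residue_eq_zero_iff]
    exact (P.v.valuationSubring.valuation_lt_one_iff _).trans
      P.v.isEquiv_valuation_valuationSubring.lt_one_iff_lt_one.symm
  have hrs : Function.Surjective r := fun y => by
    obtain ⟨x, hx⟩ := IsLocalRing.residue_surjective (R := ↥P.v.valuationSubring) y
    exact ⟨⟨x.1, x.2⟩, hx⟩
  have hfin : Module.Finite k (IsLocalRing.ResidueField P.v.valuationSubring) :=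
    finite_of_surjective_of_map_mul_eq_zero P.integers htr huO r.toLinearMap hrs fun o => by
      change r (⟨u, huO⟩ * o) = 0
      rw [map_mul, (hr ⟨u, huO⟩).mpr hu, zero_mul]
  refine ⟨hd ▸ Module.finrank_pos, ?_⟩
  let e := (Module.finBasis k (IsLocalRing.ResidueField P.v.valuationSubring)).equivFun
  refine ⟨e.toLinearMap.comp r.toLinearMap, e.surjective.comp hrs, fun x => ?_⟩
  rw [← hr]
  exact e.map_eq_zero_iff

end Places

/-- A valuation ring of a function field of one variable containing the base field is
noetherian. -/
theorem isNoetherianRing_subalgebraOfBase {k F : Type} [Field k] [Field F] [Algebra k F]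
    (hfin : ∀ u : F, Transcendental k u → FiniteDimensional k⟮u⟯ F)
    (V : ValuationSubring F) (hV : ∀ c : k, algebraMap k F c ∈ V) : IsNoetherianRing V := by
  have hA : IsNoetherianRing (V.subalgebraOfBase hV) := by
    rw [isNoetherianRing_iff_ideal_fg]
    intro I
    by_cases hI : I = ⊥
    · exact hI ▸ Submodule.fg_bot
    obtain ⟨x, hxI, hx0⟩ := Submodule.exists_mem_ne_zero_of_ne_bot hI
    have hx0' : (x : F) ≠ 0 := fun h => hx0 (Subtype.ext h)
    by_cases hxu : (x : F)⁻¹ ∈ V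
    · have : I = ⊤ := by
        rw [Ideal.eq_top_iff_one]
        have : (1 : V.subalgebraOfBase hV) = ⟨(x : F)⁻¹, hxu⟩ * x := by
          refine Subtype.ext ?_
          simp [hx0']
        exact this ▸ I.mul_mem_left _ hxI
      exact this ▸ (Ideal.fg_top _)
    have htr : Transcendental k (x : F) := fun h => hxu (V.mem_of_isAlgebraic hV h.inv)
    have := hfin _ htr
    have hQ : Module.Finite k (V.subalgebraOfBase hV ⧸ Ideal.span {x}) :=
      finite_of_surjective_of_map_mul_eq_zero (V.subalgebraOfBase hV) htr x.2
        (Ideal.Quotient.mkₐ k (Ideal.span {x})).toLinearMap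
        (Ideal.Quotient.mkₐ_surjective k _) fun o => by
          change Ideal.Quotient.mk _ (x * o) = 0
          rw [Ideal.Quotient.eq_zero_iff_mem]
          exact Ideal.mul_mem_right _ _ (Ideal.mem_span_singleton_self x)
    have hN : IsNoetherian (V.subalgebraOfBase hV) (V.subalgebraOfBase hV ⧸ Ideal.span {x}) :=
      isNoetherian_of_tower k inferInstance
    refine Submodule.fg_of_fg_map_of_fg_inf_ker (Ideal.span {x}).mkQ (IsNoetherian.noetherian _) ?_
    rw [Submodule.ker_mkQ, inf_eq_right.mpr ((Ideal.span_singleton_le_iff_mem I).mpr hxI)]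
    exact ⟨{x}, by simp [Ideal.span]⟩
  exact hA

/-- A transcendental element of a function field of one variable has a pole. -/
theorem exists_place_one_lt {k F : Type} [Field k] [Field F] [Algebra k F]
    (hfin : ∀ u : F, Transcendental k u → FiniteDimensional k⟮u⟯ F) {h : F}
    (hh : Transcendental k h) : ∃ P : PlaceOf k F, 1 < P.v h := by
  have hclos : Subring.closure (Set.range (algebraMap k F)) = (algebraMap k F).range :=
    Subring.closure_eq (algebraMap k F).range
  have h1 : h ∉ (integralClosure (Subring.closure (Set.range (algebraMap k F))) F).toSubring := by
    intro hmem
    have key (R : Subring F) (hR : R = (algebraMap k F).range) (hi : IsIntegral R h) : False := by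
      subst hR
      obtain ⟨p, hp, hpx⟩ := hi
      obtain ⟨q, rfl⟩ := Polynomial.map_surjective _ (algebraMap k F).rangeRestrict_surjective p
      rw [Polynomial.eval₂_map] at hpx
      exact hh ⟨q, fun h0 => by simp [h0] at hp, hpx⟩
    exact key _ hclos hmem
  rw [← iInf_valuationSubring_superset, Subring.mem_iInf] at h1
  push Not at h1
  obtain ⟨⟨V, hV⟩, hhV⟩ := h1
  have hV' (c : k) : algebraMap k F c ∈ V := hV ⟨c, rfl⟩
  have := isNoetherianRing_subalgebraOfBase hfin V hV'
  have hh0 : h ≠ 0 := fun h0 => hh (h0 ▸ isAlgebraic_zero)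
  have hu : h⁻¹ ∈ V := (V.mem_or_inv_mem h).resolve_left hhV
  have hum : (⟨h⁻¹, hu⟩ : V) ∈ IsLocalRing.maximalIdeal V := by
    rw [IsLocalRing.mem_maximalIdeal, mem_nonunits_iff]
    intro hun
    refine hhV ?_
    obtain ⟨y, hy⟩ := isUnit_iff_exists_inv.mp hun
    have : h = y := by
      have : h⁻¹ * (y : F) = 1 := congrArg Subtype.val hy
      exact (inv_mul_eq_one₀ hh0).mp this
    exact this ▸ y.2
  let M : IsDedekindDomain.HeightOneSpectrum V :=
    { asIdeal := IsLocalRing.maximalIdeal V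
      isPrime := inferInstance
      ne_bot := fun hb => by
        rw [hb, Ideal.mem_bot] at hum
        exact inv_ne_zero hh0 (congrArg Subtype.val hum) }
  refine ⟨⟨M.valuation F, M.valuation_surjective F, fun c hc => ?_⟩, ?_⟩
  · refine le_antisymm (M.valuation_le_one (K := F) ⟨_, hV' c⟩) ?_
    have := M.valuation_le_one (K := F) (⟨_, hV' c⁻¹⟩ : V)
    change M.valuation F (algebraMap k F c⁻¹) ≤ 1 at this
    rw [map_inv₀, map_inv₀] at this
    refine (inv_le_one₀ (zero_lt_iff.mpr ?_)).mp this
    simpa using hc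
  · have := (M.valuation_lt_one_iff_mem (K := F) (⟨h⁻¹, hu⟩ : V)).mpr hum
    change M.valuation F h⁻¹ < 1 at this
    rw [map_inv₀] at this
    exact (inv_lt_one₀ (zero_lt_iff.mpr (by simpa using hh0))).mp this

section Approximation

variable {k F : Type} [Field k] [Field F] [Algebra k F]

theorem PlaceOf.exists_v_eq_exp (P : PlaceOf k F) {x : F} (hx : x ≠ 0) :
    ∃ m : ℤ, P.v x = WithZero.exp m :=
  ⟨WithZero.log (P.v x), (WithZero.exp_log ((Valuation.ne_zero_iff _).mpr hx)).symm⟩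

theorem PlaceOf.ne_zero_of_v_eq_exp (P : PlaceOf k F) {x : F} {m : ℤ}
    (hx : P.v x = WithZero.exp m) : x ≠ 0 :=
  (Valuation.ne_zero_iff P.v).mp (hx ▸ WithZero.exp_ne_zero)

theorem PlaceOf.ext_of_lt_one_iff {P Q : PlaceOf k F} (h : ∀ x, P.v x < 1 ↔ Q.v x < 1) :
    P = Q := by
  have h1 (x : F) (hx : P.v x = 1) : Q.v x = 1 := by
    refine le_antisymm ?_ ?_
    · by_contra! hc
      have := (h x⁻¹).mpr (by
        rw [map_inv₀]
        exact (inv_lt_one₀ (zero_lt_one.trans hc)).mpr hc)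
      simp [hx] at this
    · by_contra! hc
      exact absurd hx ((h x).mpr hc).ne
  obtain ⟨t, ht⟩ := P.exists_uniformizer
  have ht0 : t ≠ 0 := P.ne_zero_of_v_eq_exp ht
  obtain ⟨a, ha⟩ := Q.exists_v_eq_exp ht0
  have key (x : F) (m : ℤ) (hx : P.v x = WithZero.exp m) : Q.v x = WithZero.exp (-(m * a)) := by
    have := h1 (x * t ^ m) (by
      rw [map_mul, map_zpow₀, hx, ht, ← WithZero.exp_zsmul, ← WithZero.exp_add]
      simp)
    rw [map_mul, map_zpow₀, ha, ← WithZero.exp_zsmul] at this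
    rw [WithZero.exp_neg, ← smul_eq_mul]
    exact eq_inv_of_mul_eq_one_left this
  have ha0 : a < 0 := by
    have := (h t).mp (by rw [ht, ← WithZero.exp_zero, WithZero.exp_lt_exp]; simp)
    rwa [ha, ← WithZero.exp_zero, WithZero.exp_lt_exp] at this
  have ha1 : a = -1 := by
    obtain ⟨s, hs⟩ := Q.exists_uniformizer
    have hs0 : s ≠ 0 := Q.ne_zero_of_v_eq_exp hs
    obtain ⟨m, hm⟩ := P.exists_v_eq_exp hs0
    have := (key s m hm).symm.trans hs
    rw [WithZero.exp_inj] at this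
    have hma : m * a = 1 := by linarith
    rcases Int.isUnit_iff.mp (IsUnit.of_mul_eq_one_right m hma) with h | h <;> omega
  have hv : P.v = Q.v := by
    ext x
    rcases eq_or_ne x 0 with rfl | hx
    · simp
    obtain ⟨m, hm⟩ := P.exists_v_eq_exp hx
    rw [hm, key x m hm, ha1]
    simp
  cases P; cases Q; cases hv; rfl

/-- The real absolute value attached to a place. -/
noncomputable def PlaceOf.absoluteValue (P : PlaceOf k F) : AbsoluteValue F ℝ where
  toFun x := (WithZeroMulInt.toNNReal (e := 2) two_ne_zero (P.v x) : NNReal)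
  map_mul' x y := by simp
  nonneg' x := NNReal.coe_nonneg _
  eq_zero' x := by simp
  add_le' x y := by
    have hm := (WithZeroMulInt.toNNReal_strictMono (e := 2) one_lt_two).monotone
    have := hm (P.v.map_add x y)
    rw [hm.map_max] at this
    rw [← NNReal.coe_add, NNReal.coe_le_coe]
    exact this.trans (max_le_add_of_nonneg zero_le zero_le)

theorem PlaceOf.absoluteValue_lt_one_iff (P : PlaceOf k F) {x : F} :
    P.absoluteValue x < 1 ↔ P.v x < 1 := by
  have hm := WithZeroMulInt.toNNReal_strictMono (e := 2) one_lt_two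
  change ((WithZeroMulInt.toNNReal (e := 2) two_ne_zero (P.v x) : NNReal) : ℝ) < 1 ↔ _
  rw [← NNReal.coe_one, NNReal.coe_lt_coe, ← map_one (WithZeroMulInt.toNNReal (e := 2) two_ne_zero)]
  exact hm.lt_iff_lt

theorem PlaceOf.one_lt_absoluteValue_iff (P : PlaceOf k F) {x : F} :
    1 < P.absoluteValue x ↔ 1 < P.v x := by
  have hm := WithZeroMulInt.toNNReal_strictMono (e := 2) one_lt_two
  change 1 < ((WithZeroMulInt.toNNReal (e := 2) two_ne_zero (P.v x) : NNReal) : ℝ) ↔ _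
  rw [← NNReal.coe_one, NNReal.coe_lt_coe, ← map_one (WithZeroMulInt.toNNReal (e := 2) two_ne_zero)]
  exact hm.lt_iff_lt

theorem PlaceOf.absoluteValue_isNontrivial (P : PlaceOf k F) : P.absoluteValue.IsNontrivial := by
  obtain ⟨t, ht⟩ := P.exists_uniformizer
  refine ⟨t, P.ne_zero_of_v_eq_exp ht, ((P.absoluteValue_lt_one_iff).mpr ?_).ne⟩
  rw [ht, ← WithZero.exp_zero, WithZero.exp_lt_exp]
  simp

theorem exists_one_lt_and_lt_one (S : Finset (PlaceOf k F)) {P : PlaceOf k F} (hP : P ∈ S) :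
    ∃ a : F, 1 < P.v a ∧ ∀ Q ∈ S, Q ≠ P → Q.v a < 1 := by
  obtain ⟨a, ha, ha'⟩ := AbsoluteValue.exists_one_lt_lt_one_pi_of_not_isEquiv
    (v := fun Q : S => Q.1.absoluteValue) (fun Q => Q.1.absoluteValue_isNontrivial)
    (fun Q R hQR hE => hQR <| Subtype.ext <| PlaceOf.ext_of_lt_one_iff fun x => by
      rw [← PlaceOf.absoluteValue_lt_one_iff, ← PlaceOf.absoluteValue_lt_one_iff]
      exact hE.lt_one_iff) ⟨P, hP⟩
  exact ⟨a, P.one_lt_absoluteValue_iff.mp ha, fun Q hQ hQP =>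
    Q.absoluteValue_lt_one_iff.mp (ha' ⟨Q, hQ⟩ fun h => hQP (congrArg Subtype.val h))⟩

/-- Weak approximation at a finite set of places. -/
theorem exists_approximation (S : Finset (PlaceOf k F)) {P : PlaceOf k F} (hP : P ∈ S) (y : F)
    (M : ℤ) : ∃ z : F, P.v (z - y) ≤ WithZero.exp M ∧ ∀ Q ∈ S, Q ≠ P → Q.v z ≤ WithZero.exp M := by
  rcases eq_or_ne y 0 with rfl | hy
  · exact ⟨0, by simp, by simp⟩
  obtain ⟨a, ha, ha'⟩ := exists_one_lt_and_lt_one S hP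
  have ha0 : a ≠ 0 := by rintro rfl; simp at ha
  obtain ⟨N, hN⟩ : ∃ N : ℕ, 0 < N ∧ ∀ Q ∈ S, Q.v y * WithZero.exp (-(N : ℤ)) ≤ WithZero.exp M := by
    refine ⟨∑ Q ∈ S, (WithZero.log (Q.v y) - M).toNat + 1, by omega, fun Q hQ => ?_⟩
    obtain ⟨m, hm⟩ := Q.exists_v_eq_exp hy
    have := Finset.single_le_sum (f := fun Q : PlaceOf k F => (WithZero.log (Q.v y) - M).toNat)
      (fun _ _ => Nat.zero_le _) hQ
    simp only [hm, WithZero.log_exp] at this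
    rw [hm, ← WithZero.exp_add, WithZero.exp_le_exp]
    push_cast
    have h2 := Int.self_le_toNat (m - M)
    have h3 : ((m - M).toNat : ℤ) ≤
      (∑ Q ∈ S, (WithZero.log (Q.v y) - M).toNat : ℕ) := by exact_mod_cast this
    push_cast at h3
    linarith
  have hsmall (Q : PlaceOf k F) (b : F) (hb : Q.v b < 1) : Q.v (b ^ N) ≤ WithZero.exp (-(N : ℤ)) := by
    rcases eq_or_ne b 0 with rfl | hb0
    · simp [hN.1.ne']
    obtain ⟨m, hm⟩ := Q.exists_v_eq_exp hb0
    rw [hm, ← WithZero.exp_zero, WithZero.exp_lt_exp] at hb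
    rw [map_pow, hm, ← WithZero.exp_nsmul, WithZero.exp_le_exp, nsmul_eq_mul]
    nlinarith
  have hinv : P.v (a⁻¹) < 1 := by
    rw [map_inv₀]
    exact (inv_lt_one₀ (zero_lt_one.trans ha)).mpr ha
  have hlt1 : WithZero.exp (-(N : ℤ)) < 1 := by
    rw [← WithZero.exp_zero, WithZero.exp_lt_exp]
    omega
  have hone (Q : PlaceOf k F) (b : F) (hb : Q.v b < 1) : Q.v (1 + b ^ N) = 1 := by
    have := Valuation.map_add_eq_of_lt_right Q.v (x := b ^ N) (y := 1)
      (by rw [map_one]; exact (hsmall Q b hb).trans_lt hlt1)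
    rwa [add_comm, map_one] at this
  have hPone := hone P _ hinv
  have hne : (1 + a⁻¹ ^ N) ≠ 0 := by
    intro h0
    rw [h0, map_zero] at hPone
    exact zero_ne_one hPone
  refine ⟨y * (1 + a⁻¹ ^ N)⁻¹, ?_, fun Q hQ hQP => ?_⟩
  · have : y * (1 + a⁻¹ ^ N)⁻¹ - y = - (y * a⁻¹ ^ N * (1 + a⁻¹ ^ N)⁻¹) := by
      have e : (1 + a⁻¹ ^ N) * (1 + a⁻¹ ^ N)⁻¹ = 1 := mul_inv_cancel₀ hne
      linear_combination y * e
    rw [this, Valuation.map_neg, map_mul, map_inv₀, hPone, inv_one, mul_one, map_mul]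
    exact (mul_le_mul' le_rfl (hsmall P _ hinv)).trans (hN.2 P hP)
  · have h1 := hone Q a (ha' Q hQ hQP)
    have hne1 : (1 + a ^ N) ≠ 0 := by
      intro h0
      simp [h0] at h1
    have : y * (1 + a⁻¹ ^ N)⁻¹ = y * a ^ N * (1 + a ^ N)⁻¹ := by
      have e : 1 + a⁻¹ ^ N = (1 + a ^ N) * (a ^ N)⁻¹ := by
        have := pow_ne_zero N ha0
        rw [inv_pow]
        field_simp
        ring
      rw [e, mul_inv, inv_inv]
      ring
    rw [this, map_mul, map_inv₀, h1, inv_one, mul_one, map_mul]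
    exact (mul_le_mul' le_rfl (hsmall Q _ (ha' Q hQ hQP))).trans (hN.2 Q hQ)

end Approximation

section DegreeBound

variable {k F : Type} [Field k] [Field F] [Algebra k F]

theorem PlaceOf.v_sum_le (P : PlaceOf k F) {ι : Type} (s : Finset ι) (x : ι → F)
    {r : WithZero (Multiplicative ℤ)} (h : ∀ i ∈ s, P.v (x i) ≤ r) : P.v (∑ i ∈ s, x i) ≤ r :=
  Valuation.map_sum_le _ h

theorem PlaceOf.eq_zero_of_v_sum_pow_le (P : PlaceOf k F) {t : F} (ht : P.v t = WithZero.exp (-1))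
    {d : ℕ} (b : Fin d → F) (hb : ∀ j, P.v (b j) ≤ 1)
    (hind : ∀ c : Fin d → k, P.v (∑ j, c j • b j) < 1 → c = 0) (e : ℕ) (c : Fin e → Fin d → k)
    (hc : P.v (∑ i, ∑ j, c i j • (t ^ (i : ℕ) * b j)) ≤ WithZero.exp (-(e : ℤ))) : c = 0 := by
  induction e with
  | zero => exact Subsingleton.elim _ _
  | succ e ih =>
    have ht0 := P.ne_zero_of_v_eq_exp ht
    have hlt : WithZero.exp (-1 : ℤ) < 1 := by
      rw [← WithZero.exp_zero, WithZero.exp_lt_exp]; simp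
    have htle : P.v t ≤ 1 := ht ▸ hlt.le
    rw [Fin.sum_univ_succ] at hc
    have hrest : ∑ i : Fin e, ∑ j, c i.succ j • (t ^ (i.succ : ℕ) * b j) =
        t * ∑ i : Fin e, ∑ j, c i.succ j • (t ^ (i : ℕ) * b j) := by
      simp only [Finset.mul_sum, Fin.val_succ, pow_succ', mul_smul_comm, mul_assoc]
    have hR : P.v (∑ i : Fin e, ∑ j, c i.succ j • (t ^ (i : ℕ) * b j)) ≤ 1 :=
      P.v_sum_le _ _ fun i _ => P.v_sum_le _ _ fun j _ => (P.v_smul_le _ _).trans (by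
        rw [map_mul, map_pow]
        exact mul_le_one' (pow_le_one' htle _) (hb j))
    rw [hrest] at hc
    set R := ∑ i : Fin e, ∑ j, c i.succ j • (t ^ (i : ℕ) * b j) with hRdef
    have htR : P.v (t * R) < 1 := by
      rw [map_mul, ht]
      exact (mul_le_of_le_one_right' hR).trans_lt hlt
    have hA : P.v (∑ j, c 0 j • b j) < 1 := by
      have h1 : ∑ j, c 0 j • (t ^ ((0 : Fin (e + 1)) : ℕ) * b j) = ∑ j, c 0 j • b j := by simp
      rw [h1] at hc
      have h2 := P.v.map_sub (∑ j, c 0 j • b j + t * R) (t * R)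
      rw [add_sub_cancel_right] at h2
      refine h2.trans_lt (max_lt (hc.trans_lt ?_) htR)
      rw [← WithZero.exp_zero, WithZero.exp_lt_exp]
      omega
    have h0 := hind _ hA
    have hc' : P.v R ≤ WithZero.exp (-(e : ℤ)) := by
      have h1 : ∑ j, c 0 j • (t ^ ((0 : Fin (e + 1)) : ℕ) * b j) = 0 := by simp [h0]
      rw [h1, zero_add, map_mul, ht] at hc
      have : P.v R = WithZero.exp 1 * (WithZero.exp (-1) * P.v R) := by
        rw [← mul_assoc, ← WithZero.exp_add]; simp
      rw [this]
      refine (mul_le_mul' le_rfl hc).trans ?_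
      rw [← WithZero.exp_add, WithZero.exp_le_exp]
      push_cast
      linarith
    have h3 := ih (fun i => c i.succ) hc'
    funext i
    refine Fin.cases h0 (fun i => ?_) i
    exact congrFun h3 i

/-- The degree of the zero divisor of `u` is at most `[F : k(u)]`. -/
theorem sum_mul_degree_le_finrank {u : F} (hu : Transcendental k u)
    [FiniteDimensional k⟮u⟯ F] (S : Finset (PlaceOf k F)) (e : PlaceOf k F → ℕ)
    (hS : ∀ P ∈ S, 0 < e P ∧ P.v u = WithZero.exp (-(e P : ℤ))) :
    ∑ P ∈ S, e P * P.degree ≤ Module.finrank k⟮u⟯ F := by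
  classical
  have hu0 : u ≠ 0 := fun h => hu (h ▸ isAlgebraic_zero)
  have hlt (P) (hP : P ∈ S) : P.v u < 1 := by
    rw [(hS P hP).2, ← WithZero.exp_zero, WithZero.exp_lt_exp]
    have := (hS P hP).1
    omega
  have hbex (P : PlaceOf k F) : ∃ b : Fin P.degree → F, P ∈ S → (∀ j, P.v (b j) ≤ 1) ∧
      ∀ c : Fin P.degree → k, P.v (∑ j, c j • b j) < 1 → c = 0 := by
    by_cases hP : P ∈ S
    · obtain ⟨-, ρ, hρ, hρ0⟩ := P.exists_reduction (hlt P hP) hu0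
      choose g hg using hρ
      refine ⟨fun j => g (Pi.single j 1), fun _ => ⟨fun j => (g (Pi.single j 1)).2, fun c hc => ?_⟩⟩
      have h1 : ρ (∑ j, c j • g (Pi.single j 1)) = 0 := by
        rw [hρ0]
        simpa using hc
      rw [map_sum] at h1
      simp only [map_smul, hg] at h1
      rw [← h1]
      exact pi_eq_sum_univ' c
    · exact ⟨0, fun h => absurd h hP⟩
  choose b hb using hbex
  choose t ht using fun P : PlaceOf k F => P.exists_uniformizer
  let ι := Σ P : S, Fin (e P.1) × Fin P.1.degree
  let y : ι → F := fun x => t x.1.1 ^ (x.2.1 : ℕ) * b x.1.1 x.2.2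
  let E : ℕ := ∑ P ∈ S, e P
  have hE (P) (hP : P ∈ S) : WithZero.exp (-(E : ℤ)) ≤ WithZero.exp (-(e P : ℤ)) := by
    rw [WithZero.exp_le_exp]
    have := Finset.single_le_sum (f := e) (fun _ _ => Nat.zero_le _) hP
    simp only [E]
    omega
  have hexle (m : ℕ) : WithZero.exp (-(m : ℤ)) ≤ 1 := by
    rw [← WithZero.exp_zero, WithZero.exp_le_exp]
    omega
  choose z hz hz' using fun x : ι => exists_approximation S x.1.2 (y x) (-(E : ℤ))
  have hy (x : ι) : x.1.1.v (y x) ≤ 1 := by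
    simp only [y, map_mul, map_pow, ht]
    exact mul_le_one' (pow_le_one' (by simpa using hexle 1) _) ((hb _ x.1.2).1 _)
  have hzle (x : ι) (P) (hP : P ∈ S) : P.v (z x) ≤ 1 := by
    by_cases h : P = x.1.1
    · subst h
      have := x.1.1.v.map_add (z x - y x) (y x)
      rw [sub_add_cancel] at this
      exact this.trans (max_le ((hz x).trans (hexle E)) (hy x))
    · exact (hz' x P hP h).trans (hexle E)
  let O : Subalgebra k F := ⨅ P ∈ S, P.integers
  have hO {x : F} : x ∈ O ↔ ∀ P ∈ S, P.v x ≤ 1 := by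
    simp only [O, Algebra.mem_iInf, PlaceOf.mem_integers]
  have hli : LinearIndependent k⟮u⟯ z := by
    refine linearIndependent_adjoin_simple_of_mod O hu (hO.mpr fun P hP => (hlt P hP).le) z
      (fun x => hO.mpr (hzle x)) ?_
    rintro c ⟨o, ho, hc⟩
    funext ⟨⟨P, hP⟩, i, j⟩
    have h1 : P.v (∑ x, c x • z x) ≤ WithZero.exp (-(e P : ℤ)) := by
      rw [hc, map_mul, (hS P hP).2]
      exact mul_le_of_le_one_right' (hO.mp ho P hP)
    have h2 : P.v (∑ x, c x • (z x - if x.1.1 = P then y x else 0)) ≤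
        WithZero.exp (-(e P : ℤ)) := by
      refine P.v_sum_le _ _ fun x _ => (P.v_smul_le _ _).trans ?_
      split_ifs with h
      · subst h
        exact (hz x).trans (hE _ hP)
      · rw [sub_zero]
        exact (hz' x P hP (Ne.symm h)).trans (hE _ hP)
    have h3 : ∑ x : ι, c x • (if x.1.1 = P then y x else 0) =
        ∑ i : Fin (e P), ∑ j : Fin P.degree, c ⟨⟨P, hP⟩, i, j⟩ • (t P ^ (i : ℕ) * b P j) := by
      rw [Fintype.sum_sigma, Finset.sum_eq_single (⟨P, hP⟩ : S)]
      · rw [Fintype.sum_prod_type]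
        simp [y]
      · intro Q _ hQ
        refine Finset.sum_eq_zero fun x _ => ?_
        rw [if_neg fun h => hQ (Subtype.ext h), smul_zero]
      · simp
    have h4 := (P.v.map_sub _ _).trans (max_le h1 h2)
    rw [← Finset.sum_sub_distrib] at h4
    simp only [← smul_sub, sub_sub_cancel] at h4
    rw [h3] at h4
    have := P.eq_zero_of_v_sum_pow_le (ht P) (b P) (hb P hP).1 (hb P hP).2 (e P)
      (fun i j => c ⟨⟨P, hP⟩, i, j⟩) h4
    exact congrFun (congrFun this i) j
  have hcard := hli.fintype_card_le_finrank
  rw [Fintype.card_sigma] at hcard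
  simp only [Fintype.card_prod, Fintype.card_fin] at hcard
  rwa [Finset.sum_coe_sort S (fun P => e P * P.degree)] at hcard

theorem finite_setOf_one_lt {w : F} (hw : Transcendental k w) [FiniteDimensional k⟮w⁻¹⟯ F] :
    {P : PlaceOf k F | 1 < P.v w}.Finite := by
  by_contra hinf
  obtain ⟨S, hS, hcard⟩ := Set.Infinite.exists_subset_card_eq hinf
    (Module.finrank k⟮w⁻¹⟯ F + 1)
  have hw' : Transcendental k w⁻¹ := fun h => hw (inv_inv w ▸ h.inv)
  have hw0 : w⁻¹ ≠ 0 := fun h => hw' (h ▸ isAlgebraic_zero)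
  have hlt (P) (hP : P ∈ S) : P.v w⁻¹ < 1 := by
    have h1 : 1 < P.v w := hS hP
    rw [map_inv₀]
    exact (inv_lt_one₀ (zero_lt_one.trans h1)).mpr h1
  have := sum_mul_degree_le_finrank hw' S (fun P => (-WithZero.log (P.v w⁻¹)).toNat) fun P hP => by
    obtain ⟨m, hm⟩ := P.exists_v_eq_exp hw0
    have h1 := hlt P hP
    rw [hm, ← WithZero.exp_zero, WithZero.exp_lt_exp] at h1
    rw [hm, WithZero.log_exp]
    refine ⟨by omega, ?_⟩
    congr 1
    omega
  have h2 : ∑ P ∈ S, 1 ≤ Module.finrank k⟮w⁻¹⟯ F := by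
    refine (Finset.sum_le_sum fun P hP => ?_).trans this
    obtain ⟨m, hm⟩ := P.exists_v_eq_exp hw0
    have h1 := hlt P hP
    have hd := (P.exists_reduction h1 hw0).1
    rw [hm, ← WithZero.exp_zero, WithZero.exp_lt_exp] at h1
    rw [hm, WithZero.log_exp]
    exact Nat.mul_pos (by omega) hd
  simp [hcard] at h2

end DegreeBound

section RiemannRoch

variable {k F : Type} [Field k] [Field F] [Algebra k F]

theorem PlaceOf.v_eq_one_of_isAlgebraic (P : PlaceOf k F) {x : F} (hx : IsAlgebraic k x)
    (h0 : x ≠ 0) : P.v x = 1 := by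
  refine le_antisymm (P.v_le_one_of_isAlgebraic hx) ?_
  by_contra! h
  exact P.transcendental_of_lt_one h h0 hx

theorem linearIndependent_adjoin_simple_of_isAlgebraic
    (hfin : ∀ u : F, Transcendental k u → FiniteDimensional k⟮u⟯ F) {f : F}
    (hf : Transcendental k f) {ι : Type} [Fintype ι] {x : ι → F} (hx : LinearIndependent k x)
    (halg : ∀ i, IsAlgebraic k (x i)) : LinearIndependent k⟮f⟯ x := by
  obtain ⟨P, hP⟩ := exists_place_one_lt hfin (h := f⁻¹) fun h => hf (inv_inv f ▸ h.inv)
  have hf0 : f ≠ 0 := fun h => hf (h ▸ isAlgebraic_zero)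
  have hlt : P.v f < 1 := by
    rw [map_inv₀] at hP
    exact (one_lt_inv₀ (zero_lt_iff.mpr ((Valuation.ne_zero_iff _).mpr hf0))).mp hP
  refine linearIndependent_adjoin_simple_of_mod P.integers hf hlt.le x
    (fun i => P.v_le_one_of_isAlgebraic (halg i)) ?_
  rintro c ⟨o, ho, hc⟩
  have h0 : ∑ i, c i • x i = 0 := by
    by_contra hne
    have hintg : IsIntegral k (∑ i, c i • x i) :=
      IsIntegral.sum _ fun i _ => ((halg i).smul (c i)).isIntegral
    have h1 := P.v_eq_one_of_isAlgebraic hintg.isAlgebraic hne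
    rw [hc, map_mul] at h1
    exact (mul_lt_one_of_lt_of_le hlt ho).ne h1
  funext i
  exact Fintype.linearIndependent_iff.mp hx c h0 i

theorem isAlgebraic_of_mem_RRSpace_zero
    (hfin : ∀ u : F, Transcendental k u → FiniteDimensional k⟮u⟯ F) {x : F}
    (hx : x ∈ RRSpace k F 0) : IsAlgebraic k x := by
  by_contra h
  obtain ⟨P, hP⟩ := exists_place_one_lt hfin h
  exact absurd hP (not_lt.mpr (hx P))

theorem mem_RRSpace_zero_of_isAlgebraic {x : F} (hx : IsAlgebraic k x) : x ∈ RRSpace k F 0 :=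
  fun P => P.v_le_one_of_isAlgebraic hx

theorem finiteDimensional_RRSpace_zero
    (hfin : ∀ u : F, Transcendental k u → FiniteDimensional k⟮u⟯ F) {f : F}
    (hf : Transcendental k f) : FiniteDimensional k (RRSpace k F 0) := by
  have := hfin f hf
  rw [FiniteDimensional, ← Module.rank_lt_aleph0_iff]
  refine (rank_le (n := Module.finrank k⟮f⟯ F) fun s hs => ?_).trans_lt (Cardinal.natCast_lt_aleph0)
  have h1 : LinearIndependent k (fun i : s => ((i.1 : RRSpace k F 0) : F)) :=
    hs.map' (RRSpace k F 0).subtype (Submodule.ker_subtype _)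
  have h2 := linearIndependent_adjoin_simple_of_isAlgebraic hfin hf h1
    fun i => isAlgebraic_of_mem_RRSpace_zero hfin i.1.2
  exact (Fintype.card_coe s).symm.trans_le h2.fintype_card_le_finrank

theorem mem_RRSpace {D : PlaceOf k F →₀ ℤ} {x : F} :
    x ∈ RRSpace k F D ↔ ∀ P : PlaceOf k F, P.v x ≤ WithZero.exp (D P) := Iff.rfl

theorem finrank_le_of_ker {V W U : Type} [AddCommGroup V] [Module k V] [AddCommGroup W]
    [Module k W] [AddCommGroup U] [Module k U] [FiniteDimensional k W] [FiniteDimensional k U]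
    (φ : V →ₗ[k] W) (ψ : LinearMap.ker φ →ₗ[k] U) (hψ : Function.Injective ψ) :
    FiniteDimensional k V ∧ Module.finrank k V ≤ Module.finrank k U + Module.finrank k W := by
  have h1 : FiniteDimensional k (LinearMap.ker φ) := Module.Finite.of_injective ψ hψ
  have h2 : FiniteDimensional k (V ⧸ LinearMap.ker φ) :=
    Module.Finite.equiv φ.quotKerEquivRange.symm
  have h3 : FiniteDimensional k V := Module.Finite.of_submodule_quotient (LinearMap.ker φ)
  refine ⟨h3, ?_⟩
  rw [← φ.finrank_range_add_finrank_ker, add_comm]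
  exact add_le_add (LinearMap.finrank_le_finrank_of_injective hψ) (Submodule.finrank_le _)

theorem ell_add_single_le
    (hfin : ∀ u : F, Transcendental k u → FiniteDimensional k⟮u⟯ F) (D : PlaceOf k F →₀ ℤ)
    (P : PlaceOf k F) (hD : FiniteDimensional k (RRSpace k F D)) :
    FiniteDimensional k (RRSpace k F (D + Finsupp.single P 1)) ∧
      ell k F (D + Finsupp.single P 1) ≤ ell k F D + P.degree := by
  classical
  obtain ⟨t, ht⟩ := P.exists_uniformizer
  have ht0 := P.ne_zero_of_v_eq_exp ht
  have hlt : P.v t < 1 := by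
    rw [ht, ← WithZero.exp_zero, WithZero.exp_lt_exp]; simp
  have := hfin t (P.transcendental_of_lt_one hlt ht0)
  obtain ⟨-, ρ, -, hρ⟩ := P.exists_reduction hlt ht0
  have hv (x : F) : P.v (x * t ^ (D P + 1)) = P.v x * WithZero.exp (-(D P + 1)) := by
    rw [map_mul, map_zpow₀, ht, ← WithZero.exp_zsmul]
    congr 2
    simp
  have hmem (x : RRSpace k F (D + Finsupp.single P 1)) :
      (x : F) * t ^ (D P + 1) ∈ P.integers := by
    rw [PlaceOf.mem_integers, hv]
    have h1 := mem_RRSpace.mp x.2 P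
    refine (mul_le_mul' h1 le_rfl).trans ?_
    rw [← WithZero.exp_add]
    simp
  let μ : RRSpace k F (D + Finsupp.single P 1) →ₗ[k] P.integers :=
    { toFun := fun x => ⟨x * t ^ (D P + 1), hmem x⟩
      map_add' := fun x y => Subtype.ext (add_mul _ _ _)
      map_smul' := fun c x => Subtype.ext (smul_mul_assoc c (x : F) _) }
  let φ := ρ.comp μ
  have hker (x : LinearMap.ker φ) : (x.1 : F) ∈ RRSpace k F D := by
    have h1 : P.v ((x.1 : F) * t ^ (D P + 1)) < 1 := (hρ _).mp x.2
    rw [mem_RRSpace]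
    intro Q
    by_cases hQ : Q = P
    · subst hQ
      rcases eq_or_ne (x.1 : F) 0 with h0 | h0
      · simp [h0]
      · obtain ⟨m, hm⟩ := Q.exists_v_eq_exp h0
        rw [hv, hm, ← WithZero.exp_add, ← WithZero.exp_zero, WithZero.exp_lt_exp] at h1
        rw [hm, WithZero.exp_le_exp]
        omega
    · have := mem_RRSpace.mp x.1.2 Q
      rwa [Finsupp.add_apply, Finsupp.single_eq_of_ne hQ, add_zero] at this
  let ψ : LinearMap.ker φ →ₗ[k] RRSpace k F D :=
    { toFun := fun x => ⟨x.1, hker x⟩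
      map_add' := fun x y => rfl
      map_smul' := fun c x => rfl }
  have := finrank_le_of_ker φ ψ fun x y h => by
    have h1 : (x.1 : F) = y.1 := congrArg (fun z : RRSpace k F D => (z : F)) h
    exact Subtype.ext (Subtype.ext h1)
  rwa [Module.finrank_fin_fun] at this

theorem deg_add (D E : PlaceOf k F →₀ ℤ) :
    DivisorOf.deg k F (D + E) = DivisorOf.deg k F D + DivisorOf.deg k F E :=
  Finsupp.sum_add_index' (by simp) (fun P m n => add_mul _ _ _)

theorem ell_add_nat_le
    (hfin : ∀ u : F, Transcendental k u → FiniteDimensional k⟮u⟯ F) (E : PlaceOf k F →₀ ℕ) :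
    ∀ D : PlaceOf k F →₀ ℤ, FiniteDimensional k (RRSpace k F D) →
      FiniteDimensional k (RRSpace k F (D + E.mapRange (fun n : ℕ => (n : ℤ)) rfl)) ∧
      (ell k F (D + E.mapRange (fun n : ℕ => (n : ℤ)) rfl) : ℤ) ≤
        ell k F D + DivisorOf.deg k F (E.mapRange (fun n : ℕ => (n : ℤ)) rfl) := by
  classical
  induction E using Finsupp.induction_linear with
  | zero =>
    intro D hD
    rw [Finsupp.mapRange_zero, add_zero]
    exact ⟨hD, by simp [DivisorOf.deg]⟩
  | add E₁ E₂ h₁ h₂ =>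
    intro D hD
    rw [Finsupp.mapRange_add (by simp), ← add_assoc, deg_add]
    obtain ⟨hf1, hl1⟩ := h₁ D hD
    obtain ⟨hf2, hl2⟩ := h₂ _ hf1
    exact ⟨hf2, by linarith⟩
  | single P n =>
    induction n with
    | zero =>
      intro D hD
      rw [Finsupp.single_zero, Finsupp.mapRange_zero, add_zero]
      exact ⟨hD, by simp [DivisorOf.deg]⟩
    | succ n ih =>
      intro D hD
      rw [Finsupp.single_add, Finsupp.mapRange_add (by simp), ← add_assoc, deg_add]
      obtain ⟨hf1, hl1⟩ := ih D hD
      obtain ⟨hf2, hl2⟩ := ell_add_single_le hfin _ P hf1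
      rw [Finsupp.mapRange_single (a := P) (b := 1), Nat.cast_one]
      refine ⟨hf2, ?_⟩
      have : DivisorOf.deg k F (Finsupp.single P 1) = P.degree := by
        simp [DivisorOf.deg]
      rw [this]
      have h3 := Int.ofNat_le.mpr hl2
      push_cast at h3
      linarith

theorem ell_sub_deg_le_of_le
    (hfin : ∀ u : F, Transcendental k u → FiniteDimensional k⟮u⟯ F) {D D' : PlaceOf k F →₀ ℤ}
    (h : D ≤ D') (hD : FiniteDimensional k (RRSpace k F D)) :
    FiniteDimensional k (RRSpace k F D') ∧
      (ell k F D' : ℤ) - DivisorOf.deg k F D' ≤ ell k F D - DivisorOf.deg k F D := by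
  have hE : D' = D + ((D' - D).mapRange Int.toNat rfl).mapRange (fun n : ℕ => (n : ℤ)) rfl := by
    ext P
    have := h P
    simp only [Finsupp.add_apply, Finsupp.mapRange_apply, Finsupp.sub_apply]
    omega
  obtain ⟨h1, h2⟩ := ell_add_nat_le hfin ((D' - D).mapRange Int.toNat rfl) D hD
  rw [← hE] at h1 h2
  refine ⟨h1, ?_⟩
  have h3 := congrArg (DivisorOf.deg k F) hE
  rw [deg_add] at h3
  linarith

theorem finiteDimensional_RRSpace
    (hfin : ∀ u : F, Transcendental k u → FiniteDimensional k⟮u⟯ F) {f : F}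
    (hf : Transcendental k f) (D : PlaceOf k F →₀ ℤ) : FiniteDimensional k (RRSpace k F D) := by
  classical
  have h1 : FiniteDimensional k (RRSpace k F (D ⊔ 0)) :=
    (ell_sub_deg_le_of_le hfin le_sup_right (finiteDimensional_RRSpace_zero hfin hf)).1
  refine Submodule.finiteDimensional_of_le (S₂ := RRSpace k F (D ⊔ 0)) fun x hx => ?_
  rw [mem_RRSpace] at hx ⊢
  exact fun P => (hx P).trans (WithZero.exp_le_exp.mpr (by
    rw [Finsupp.sup_apply]
    exact le_sup_left))

end RiemannRoch

section BoundedBasis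

variable {k F : Type} [Field k] [Field F] [Algebra k F]

theorem finrank_mul_finrank_of_simple_le (E : IntermediateField k F) {u : F} (hu : u ∈ E) :
    Module.finrank k⟮u⟯ (extendScalars (adjoin_simple_le_iff.mpr hu)) * Module.finrank E F =
      Module.finrank k⟮u⟯ F :=
  Module.finrank_mul_finrank k⟮u⟯ (extendScalars (adjoin_simple_le_iff.mpr hu)) F

theorem card_mul_finrank_le (E : IntermediateField k F) {u : F} (hu : u ∈ E)
    [FiniteDimensional k⟮u⟯ F] {ι : Type} [Fintype ι] {x : ι → F} (hx : ∀ i, x i ∈ E)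
    (hli : LinearIndependent k⟮u⟯ x) :
    Fintype.card ι * Module.finrank E F ≤ Module.finrank k⟮u⟯ F := by
  rw [← finrank_mul_finrank_of_simple_le E hu]
  refine Nat.mul_le_mul_right _ ?_
  let x' : ι → extendScalars (adjoin_simple_le_iff.mpr hu) := fun i => ⟨x i, hx i⟩
  have : LinearIndependent k⟮u⟯ x' :=
    LinearIndependent.of_comp (extendScalars (adjoin_simple_le_iff.mpr hu)).val.toLinearMap hli
  exact this.fintype_card_le_finrank

theorem PlaceOf.v_aeval_le (P : PlaceOf k F) (f : F) {q : Polynomial k} {N : ℕ}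
    (hq : q.natDegree ≤ N) : P.v (Polynomial.aeval f q) ≤ (max 1 (P.v f)) ^ N := by
  rw [Polynomial.aeval_eq_sum_range]
  refine P.v_sum_le _ _ fun i hi => (P.v_smul_le _ _).trans ?_
  rw [map_pow]
  calc P.v f ^ i ≤ (max 1 (P.v f)) ^ i := pow_le_pow_left' (le_max_right _ _) i
    _ ≤ _ := pow_le_pow_right' (le_max_left _ _) (by
      have := Finset.mem_range.mp hi
      omega)

/-- An algebraic relation for `g` over `k(f)` of controlled degree in `f`. -/
theorem exists_relation (E : IntermediateField k F) {f g : F} (hf : Transcendental k f)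
    (hfE : f ∈ E) (E' : IntermediateField k F) (hE : E ≤ E') (hg : g ∈ E')
    [FiniteDimensional k⟮g⟯ F] {β : ℕ} (hβ : β * Module.finrank E' F = Module.finrank k⟮g⟯ F) :
    ∃ Φ : Polynomial E, Φ ≠ 0 ∧ Polynomial.aeval g Φ = 0 ∧
      ∀ m, ∃ q : Polynomial k, q.natDegree ≤ β ∧ (Φ.coeff m : F) = Polynomial.aeval f q := by
  have hpos : 0 < Module.finrank k⟮g⟯ F := Module.finrank_pos
  have hpos' : 0 < Module.finrank E' F := by
    by_contra! h
    have : Module.finrank E' F = 0 := by omega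
    simp [this] at hβ
    omega
  have hdep : ¬ LinearIndependent k⟮g⟯ (fun i : Fin (β + 1) => f ^ (i : ℕ)) := fun h => by
    have := card_mul_finrank_le E' hg (fun i => pow_mem (hE hfE) _) h
    rw [Fintype.card_fin, ← hβ, add_mul] at this
    omega
  rw [linearIndependent_adjoin_simple_iff] at hdep
  push Not at hdep
  obtain ⟨p, hp, i₀, hi₀⟩ := hdep
  have hp0 : p i₀ ≠ 0 := fun h => hi₀ (by rw [h, map_zero])
  let q (m : ℕ) : Polynomial k := ∑ i : Fin (β + 1), Polynomial.monomial (i : ℕ) ((p i).coeff m)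
  have hqc (m : ℕ) (i : Fin (β + 1)) : (q m).coeff i = (p i).coeff m := by
    simp [q, Polynomial.coeff_monomial, Fin.val_inj]
  let Φ : Polynomial E := ∑ i : Fin (β + 1),
    Polynomial.C ((⟨f, hfE⟩ : E) ^ (i : ℕ)) * (p i).map (algebraMap k E)
  have hΦ (m : ℕ) : (Φ.coeff m : F) = Polynomial.aeval f (q m) := by
    simp only [Φ, q, Polynomial.finsetSum_coeff, Polynomial.coeff_C_mul, Polynomial.coeff_map,
      map_sum, Polynomial.aeval_monomial]
    push_cast
    exact Finset.sum_congr rfl fun i _ => mul_comm _ _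
  refine ⟨Φ, fun h0 => hp0 ?_, ?_, fun m => ⟨q m, ?_, hΦ m⟩⟩
  · ext m
    rw [← hqc]
    have : Polynomial.aeval f (q m) = 0 := by rw [← hΦ, h0]; simp
    rw [(transcendental_iff.mp hf) _ this]
    simp
  · rw [← hp]
    simp only [Φ, map_sum, map_mul, Polynomial.aeval_C, Polynomial.aeval_map_algebraMap]
    refine Finset.sum_congr rfl fun i _ => ?_
    rw [mul_comm]
    rfl
  · refine Polynomial.natDegree_sum_le_of_forall_le _ _ fun i _ => ?_
    exact (Polynomial.natDegree_monomial_le _).trans (by omega)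

/-- The polynomials `a₀ X ^ t + ⋯ + a_{t - 1} X`, where `a₀, a₁, …` are the coefficients of `Φ`
starting with the leading one. -/
noncomputable def truncation {E : Type} [Field E] (Φ : Polynomial E) (t : ℕ) : Polynomial E :=
  if t = 0 then 1 else
    ∑ i ∈ Finset.range t, Polynomial.monomial (t - i) (Φ.coeff (Φ.natDegree - i))

theorem degree_truncation {E : Type} [Field E] {Φ : Polynomial E} (hΦ : Φ ≠ 0) (t : ℕ) :
    (truncation Φ t).degree = t := by
  rcases eq_or_ne t 0 with rfl | ht
  · simp [truncation]
  rw [truncation, if_neg ht]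
  have hlc : Φ.coeff Φ.natDegree ≠ 0 := by simpa using hΦ
  refine Polynomial.degree_eq_of_le_of_coeff_ne_zero ?_ ?_
  · refine (Polynomial.degree_sum_le _ _).trans (Finset.sup_le fun i _ => ?_)
    exact (Polynomial.degree_monomial_le _ _).trans (by exact_mod_cast Nat.sub_le t i)
  · rw [Polynomial.finsetSum_coeff, Finset.sum_eq_single 0]
    · simpa using hΦ
    · intro i hi hi0
      have := Finset.mem_range.mp hi
      rw [Polynomial.coeff_monomial, if_neg (by omega)]
    · intro h
      exact absurd (Finset.mem_range.mpr (Nat.pos_of_ne_zero ht)) h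

theorem linearIndependent_aeval_truncation {E : IntermediateField k F} {Φ : Polynomial E}
    (hΦ : Φ ≠ 0) (g : F) :
    LinearIndependent E (fun t : Fin (minpoly E g).natDegree =>
      Polynomial.aeval g (truncation Φ t)) := by
  let S : Polynomial.Sequence E := ⟨truncation Φ, degree_truncation hΦ⟩
  have hS := S.linearIndependent
  rw [Fintype.linearIndependent_iff]
  intro c hc
  have h0 : ∑ t : Fin (minpoly E g).natDegree, c t • truncation Φ t = 0 := by
    by_contra hne
    have h1 := minpoly.degree_le_of_ne_zero E g hne (by
      rw [map_sum, ← hc]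
      simp)
    have h2 : (∑ t : Fin (minpoly E g).natDegree, c t • truncation Φ t).degree <
        (minpoly E g).degree := by
      have hm : minpoly E g ≠ 0 := by
        intro h
        refine hne ?_
        have : IsEmpty (Fin (minpoly E g).natDegree) := by
          rw [h, Polynomial.natDegree_zero]
          infer_instance
        exact Finset.sum_of_isEmpty _
      rw [Polynomial.degree_eq_natDegree hm]
      refine (Polynomial.degree_sum_le _ _).trans_lt ?_
      rw [Finset.sup_lt_iff (WithBot.bot_lt_coe _)]
      intro t _
      refine (Polynomial.degree_smul_le _ _).trans_lt ?_
      rw [degree_truncation hΦ]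
      exact_mod_cast t.2
    exact absurd h1 (not_le.mpr h2)
  have h3 := hS.comp (fun t : Fin (minpoly E g).natDegree => (t : ℕ)) Fin.val_injective
  exact Fintype.linearIndependent_iff.mp h3 c h0

theorem PlaceOf.v_aeval_truncation_le (P : PlaceOf k F) {E : IntermediateField k F}
    {Φ : Polynomial E} {g : F} (hg : Polynomial.aeval g Φ = 0)
    {r : WithZero (Multiplicative ℤ)} (hr : ∀ m, P.v (Φ.coeff m : F) ≤ r) {t : ℕ} (ht0 : t ≠ 0)
    (ht : t ≤ Φ.natDegree) : P.v (Polynomial.aeval g (truncation Φ t)) ≤ r := by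
  have hw : Polynomial.aeval g (truncation Φ t) =
      ∑ i ∈ Finset.range t, (Φ.coeff (Φ.natDegree - i) : F) * g ^ (t - i) := by
    rw [truncation, if_neg ht0, map_sum]
    simp only [Polynomial.aeval_monomial]
    rfl
  rcases le_or_gt (P.v g) 1 with h1 | h1
  · rw [hw]
    refine P.v_sum_le _ _ fun i _ => ?_
    rw [map_mul, map_pow]
    exact (mul_le_of_le_one_right' (pow_le_one' h1 _)).trans (hr _)
  have hg0 : P.v g ≠ 0 := (zero_lt_one.trans h1).ne'
  have hsum : ∑ i ∈ Finset.range (Φ.natDegree + 1),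
      (Φ.coeff (Φ.natDegree - i) : F) * g ^ (Φ.natDegree - i) = 0 := by
    have h2 := Finset.sum_range_reflect (fun i => (Φ.coeff i : F) * g ^ i) (Φ.natDegree + 1)
    simp only [Nat.add_sub_cancel] at h2
    rw [h2, ← hg, Polynomial.aeval_eq_sum_range]
    rfl
  rw [← Finset.sum_range_add_sum_Ico _ (show t ≤ Φ.natDegree + 1 by omega)] at hsum
  have hmul : g ^ (Φ.natDegree - t) * Polynomial.aeval g (truncation Φ t) =
      - ∑ i ∈ Finset.Ico t (Φ.natDegree + 1),
        (Φ.coeff (Φ.natDegree - i) : F) * g ^ (Φ.natDegree - i) := by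
    rw [eq_neg_iff_add_eq_zero, ← hsum, hw, Finset.mul_sum]
    congr 1
    refine Finset.sum_congr rfl fun i hi => ?_
    have := Finset.mem_range.mp hi
    rw [show Φ.natDegree - i = (Φ.natDegree - t) + (t - i) by omega, pow_add]
    ring
  have hle : P.v g ^ (Φ.natDegree - t) * P.v (Polynomial.aeval g (truncation Φ t)) ≤
      P.v g ^ (Φ.natDegree - t) * r := by
    rw [← map_pow, ← map_mul, hmul, Valuation.map_neg, map_pow, mul_comm _ r]
    refine P.v_sum_le _ _ fun i hi => ?_
    have := Finset.mem_Ico.mp hi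
    rw [map_mul, map_pow]
    exact mul_le_mul' (hr _) (pow_le_pow_right' h1.le (by omega))
  exact (mul_le_mul_iff_right₀ (zero_lt_iff.mpr (pow_ne_zero _ hg0))).mp hle

theorem finrank_restrictScalars_left {K : Type} [Field K] [Algebra k K] [Algebra K F]
    [IsScalarTower k K F] (L : IntermediateField K F) :
    Module.finrank (restrictScalars k L) F = Module.finrank L F := rfl

theorem finrank_mul_finrank_restrictScalars {K : Type} [Field K] [Algebra k K] [Algebra K F]
    [IsScalarTower k K F] (L : IntermediateField K F) :
    Module.finrank K L * Module.finrank (restrictScalars k L) F = Module.finrank K F :=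
  Module.finrank_mul_finrank K L F

theorem linearIndependent_mul_intermediateField {K : Type} [Field K] [Algebra K F]
    (M : IntermediateField K F) {ι κ : Type} {y : ι → F} {w : κ → F} (hyM : ∀ s, y s ∈ M)
    (hy : LinearIndependent K y)
    (hw : LinearIndependent M w) : LinearIndependent K (fun s : ι × κ => y s.1 * w s.2) := by
  let y' : ι → M := fun s => ⟨y s, hyM s⟩
  have h2 : LinearIndependent K y' := LinearIndependent.of_comp M.val.toLinearMap hy
  exact linearIndependent_smul h2 hw

theorem linearIndependent_mul_of_mem (E : IntermediateField k F) {f : F} (hfE : f ∈ E)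
    {ι κ : Type} {y : ι → F} {w : κ → F} (hyE : ∀ s, y s ∈ E) (hy : LinearIndependent k⟮f⟯ y)
    (hw : LinearIndependent E w) : LinearIndependent k⟮f⟯ (fun s : ι × κ => y s.1 * w s.2) := by
  refine linearIndependent_mul_intermediateField (extendScalars (adjoin_simple_le_iff.mpr hfE))
    hyE hy ?_
  exact hw

/-- The subfield `E` contains `f` and has a basis over `k(f)` consisting of functions with poles
only above `f = ∞`, where the pole orders, measured in terms of the one of `f`, are bounded. -/
def HasBoundedBasis (f : F) (d : ℕ) (E : IntermediateField k F) : Prop :=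
  f ∈ E ∧ ∃ (ι : Type) (_ : Fintype ι) (y : ι → F) (N : ι → ℕ),
    Fintype.card ι * Module.finrank E F = Module.finrank k⟮f⟯ F ∧ (∀ s, y s ∈ E) ∧
    LinearIndependent k⟮f⟯ y ∧ (∀ s (P : PlaceOf k F), P.v (y s) ≤ (max 1 (P.v f)) ^ N s) ∧
    ∑ s, N s + d * Fintype.card ι ≤ Fintype.card ι * Fintype.card ι

theorem hasBoundedBasis_adjoin_algebraic
    (hfin : ∀ u : F, Transcendental k u → FiniteDimensional k⟮u⟯ F) {f : F}
    (hf : Transcendental k f) :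
    ∃ E : IntermediateField k F, HasBoundedBasis f (ell k F 0) E := by
  have := hfin f hf
  have hfin0 := finiteDimensional_RRSpace_zero hfin hf
  let t : Set F := {x | IsAlgebraic k x}
  obtain ⟨b, hbt, hspan, hli⟩ := exists_linearIndependent k⟮f⟯ t
  have hbfin : Fintype b := (LinearIndependent.setFinite hli).fintype
  have hL : (adjoin k⟮f⟯ t).toSubalgebra.toSubmodule = Submodule.span k⟮f⟯ t := by
    rw [adjoin_toSubalgebra_of_isAlgebraic fun x _ => Algebra.IsAlgebraic.isAlgebraic x,
      Algebra.adjoin_eq_span]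
    have : Submonoid.closure t = (algebraicClosure k F).toSubalgebra.toSubmonoid := by
      refine (Submonoid.closure_eq_of_le ?_ ?_)
      · intro x hx
        exact mem_algebraicClosure_iff.mpr hx
      · intro x hx
        exact Submonoid.subset_closure (mem_algebraicClosure_iff.mp hx)
    rw [this]
    congr 1
    ext x
    exact mem_algebraicClosure_iff
  have hcard : Fintype.card b = Module.finrank k⟮f⟯ (adjoin k⟮f⟯ t) := by
    have h1 := finrank_span_eq_card hli
    rw [Subtype.range_coe, hspan, ← hL] at h1
    exact h1.symm
  refine ⟨(adjoin k⟮f⟯ t).restrictScalars k, ?_, b, hbfin, Subtype.val, fun _ => 0, ?_, ?_, hli,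
    fun s P => ?_, ?_⟩
  · exact (adjoin k⟮f⟯ t).algebraMap_mem ⟨f, mem_adjoin_simple_self k f⟩
  · rw [hcard]
    exact finrank_mul_finrank_restrictScalars _
  · exact fun s => subset_adjoin k⟮f⟯ t (hbt s.2)
  · rw [pow_zero]
    exact P.v_le_one_of_isAlgebraic (hbt s.2)
  · rw [Finset.sum_const_zero, zero_add]
    refine Nat.mul_le_mul_right _ ?_
    have h1 : LinearIndependent k (fun i => ((Module.finBasis k (RRSpace k F 0) i : _) : F)) :=
      (Module.finBasis k (RRSpace k F 0)).linearIndependent.map' (RRSpace k F 0).subtype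
        (Submodule.ker_subtype _)
    have halg (i) := isAlgebraic_of_mem_RRSpace_zero hfin
      (Module.finBasis k (RRSpace k F 0) i).2
    have h2 := linearIndependent_adjoin_simple_of_isAlgebraic hfin hf h1 halg
    let x' : Fin (Module.finrank k (RRSpace k F 0)) → adjoin k⟮f⟯ t :=
      fun i => ⟨_, subset_adjoin k⟮f⟯ t (halg i)⟩
    have h3 : LinearIndependent k⟮f⟯ x' :=
      LinearIndependent.of_comp (adjoin k⟮f⟯ t).val.toLinearMap h2
    have := h3.fintype_card_le_finrank
    rwa [Fintype.card_fin, ← hcard] at this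

theorem HasBoundedBasis.adjoin_simple {f : F} (hf : Transcendental k f) {d : ℕ}
    {E : IntermediateField k F} (h : HasBoundedBasis f d E) {g : F}
    [FiniteDimensional k⟮f⟯ F] [FiniteDimensional k⟮g⟯ F]
    (hg : Module.finrank k⟮g⟯ F = Module.finrank k⟮f⟯ F) :
    HasBoundedBasis f d (restrictScalars k (adjoin E {g})) := by
  obtain ⟨hfE, ι, _, y, N, hcard, hyE, hli, hN, hsum⟩ := h
  have hEE : E ≤ restrictScalars k (adjoin E {g}) := fun x hx => E⟮g⟯.algebraMap_mem ⟨x, hx⟩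
  have hgE : g ∈ restrictScalars k (adjoin E {g}) := mem_adjoin_simple_self E g
  let M := extendScalars (adjoin_simple_le_iff.mpr hfE)
  have hEfin : FiniteDimensional E F := by
    have : FiniteDimensional M F := inferInstance
    exact this
  have hintg : IsIntegral E g := Algebra.IsIntegral.isIntegral g
  set a := (minpoly E g).natDegree with ha
  have ha' : Module.finrank E E⟮g⟯ = a := adjoin.finrank hintg
  have ha0 : 0 < a := minpoly.natDegree_pos hintg
  have hcard' : Fintype.card ι * a * Module.finrank E⟮g⟯ F = Module.finrank k⟮f⟯ F := by
    rw [← hcard, ← Module.finrank_mul_finrank E E⟮g⟯ F, ha', mul_assoc]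
  obtain ⟨Φ, hΦ0, hΦg, hΦ⟩ := exists_relation E hf hfE (restrictScalars k (adjoin E {g})) hEE hgE
    (β := Fintype.card ι * a) (by
      rw [finrank_restrictScalars_left, hcard', hg])
  have haΦ : a ≤ Φ.natDegree :=
    Polynomial.natDegree_le_of_dvd (minpoly.dvd E g hΦg) hΦ0
  refine ⟨hEE hfE, ι × Fin a, inferInstance,
    fun s => y s.1 * Polynomial.aeval g (truncation Φ s.2),
    fun s => N s.1 + min s.2.1 1 * (Fintype.card ι * a), ?_, ?_, ?_, ?_, ?_⟩
  · rw [Fintype.card_prod, Fintype.card_fin, finrank_restrictScalars_left]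
    exact hcard'
  · exact fun s => mul_mem (hEE (hyE s.1)) (aeval_mem_of_mem E⟮g⟯.toSubalgebra hgE _)
  · exact linearIndependent_mul_of_mem E hfE (y := y)
      (w := fun t : Fin a => Polynomial.aeval g (truncation Φ t)) hyE hli
      (linearIndependent_aeval_truncation hΦ0 g)
  · intro s P
    rw [map_mul, pow_add]
    refine mul_le_mul' (hN _ P) ?_
    rcases eq_or_ne (s.2 : ℕ) 0 with h0 | h0
    · rw [h0]
      simp [truncation]
    · rw [Nat.min_eq_right (Nat.one_le_iff_ne_zero.mpr h0), one_mul]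
      refine P.v_aeval_truncation_le hΦg (fun m => ?_) h0 (by omega)
      obtain ⟨q, hq, hqm⟩ := hΦ m
      rw [hqm]
      exact P.v_aeval_le f hq
  · rw [Fintype.card_prod, Fintype.card_fin, Fintype.sum_prod_type]
    clear_value a
    clear hcard' haΦ hΦ ha' ha
    obtain ⟨a, rfl⟩ : ∃ a', a = a' + 1 := ⟨a - 1, by omega⟩
    simp only [Finset.sum_add_distrib, Finset.sum_const, Finset.card_univ, Fintype.card_fin,
      smul_eq_mul]
    have hs : ∑ t : Fin (a + 1), min (t : ℕ) 1 * (Fintype.card ι * (a + 1)) =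
        a * (Fintype.card ι * (a + 1)) := by
      rw [Fin.sum_univ_succ]
      simp
    rw [hs, ← Finset.mul_sum]
    nlinarith [Nat.mul_le_mul_left (a + 1) hsum]

theorem exists_hasBoundedBasis
    (hfin : ∀ u : F, Transcendental k u → FiniteDimensional k⟮u⟯ F) {f : F}
    (hf : Transcendental k f) {ι : Type} [Finite ι] (g : ι → F)
    (hg : ∀ i, FiniteDimensional k⟮g i⟯ F ∧ Module.finrank k⟮g i⟯ F = Module.finrank k⟮f⟯ F) :
    ∃ E : IntermediateField k F, (∀ i, g i ∈ E) ∧ HasBoundedBasis f (ell k F 0) E := by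
  classical
  have := Fintype.ofFinite ι
  have := hfin f hf
  have key (s : Finset ι) : ∃ E : IntermediateField k F, (∀ i ∈ s, g i ∈ E) ∧
      HasBoundedBasis f (ell k F 0) E := by
    induction s using Finset.induction_on with
    | empty =>
      obtain ⟨E, hE⟩ := hasBoundedBasis_adjoin_algebraic hfin hf
      exact ⟨E, by simp, hE⟩
    | insert i s _ ih =>
      obtain ⟨E, hE, hE'⟩ := ih
      have := (hg i).1
      refine ⟨_, fun l hl => ?_, hE'.adjoin_simple hf (hg i).2⟩
      rcases Finset.mem_insert.mp hl with rfl | hl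
      · exact mem_adjoin_simple_self E _
      · exact E⟮g i⟯.algebraMap_mem ⟨g l, hE l hl⟩
  obtain ⟨E, hE, hE'⟩ := key Finset.univ
  exact ⟨E, fun i => hE i (Finset.mem_univ i), hE'⟩

end BoundedBasis

section Riemann

variable {k F : Type} [Field k] [Field F] [Algebra k F]

theorem PlaceOf.exists_aeval_lt_one
    (hfin : ∀ u : F, Transcendental k u → FiniteDimensional k⟮u⟯ F) (P : PlaceOf k F) {f : F}
    (hf : P.v f ≤ 1) : ∃ q : Polynomial k, q ≠ 0 ∧ P.v (Polynomial.aeval f q) < 1 := by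
  obtain ⟨t, ht⟩ := P.exists_uniformizer
  have ht0 := P.ne_zero_of_v_eq_exp ht
  have hlt : P.v t < 1 := by
    rw [ht, ← WithZero.exp_zero, WithZero.exp_lt_exp]; simp
  have := hfin t (P.transcendental_of_lt_one hlt ht0)
  obtain ⟨-, ρ, -, hρ⟩ := P.exists_reduction hlt ht0
  let b : P.integers := ⟨f, hf⟩
  have hdep : ¬ LinearIndependent k (fun i : Fin (P.degree + 1) => ρ (b ^ (i : ℕ))) := by
    intro h
    have := h.fintype_card_le_finrank
    simp at this
  rw [Fintype.not_linearIndependent_iff] at hdep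
  obtain ⟨c, hc, i, hi⟩ := hdep
  refine ⟨∑ j : Fin (P.degree + 1), Polynomial.monomial (j : ℕ) (c j), fun h => hi ?_, ?_⟩
  · have := congrArg (fun p => Polynomial.coeff p i) h
    simpa [Polynomial.finsetSum_coeff, Polynomial.coeff_monomial, Fin.val_inj] using this
  · have h1 : ρ (∑ j, c j • b ^ (j : ℕ)) = 0 := by
      rw [map_sum, ← hc]
      simp only [map_smul]
    have h2 := (hρ _).mp h1
    simpa [b, Polynomial.aeval_monomial, Algebra.smul_def] using h2

theorem exists_aeval_lt_one_of_finset
    (hfin : ∀ u : F, Transcendental k u → FiniteDimensional k⟮u⟯ F) (S : Finset (PlaceOf k F))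
    (f : F) : ∃ p : Polynomial k, p ≠ 0 ∧
      ∀ P ∈ S, P.v f ≤ 1 → P.v (Polynomial.aeval f p) < 1 := by
  classical
  induction S using Finset.induction_on with
  | empty => exact ⟨1, one_ne_zero, by simp⟩
  | insert P S _ ih =>
    obtain ⟨p, hp, hpS⟩ := ih
    have hle (Q : PlaceOf k F) (hQ : Q.v f ≤ 1) (q : Polynomial k) :
        Q.v (Polynomial.aeval f q) ≤ 1 :=
      (Q.v_aeval_le f le_rfl).trans (by rw [max_eq_left hQ, one_pow])
    by_cases hP : P.v f ≤ 1
    · obtain ⟨q, hq, hqP⟩ := P.exists_aeval_lt_one hfin hP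
      refine ⟨q * p, mul_ne_zero hq hp, fun Q hQ hQf => ?_⟩
      rw [map_mul, map_mul]
      rcases Finset.mem_insert.mp hQ with rfl | hQ
      · exact (mul_le_of_le_one_right' (hle Q hQf p)).trans_lt hqP
      · exact (mul_le_of_le_one_left' (hle Q hQf q)).trans_lt (hpS Q hQ hQf)
    · refine ⟨p, hp, fun Q hQ hQf => ?_⟩
      rcases Finset.mem_insert.mp hQ with rfl | hQ
      · exact absurd hQf hP
      · exact hpS Q hQ hQf

theorem PlaceOf.v_aeval_eq_of_one_lt (P : PlaceOf k F) {f : F} (hf : 1 < P.v f)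
    {p : Polynomial k} (hp : p ≠ 0) :
    P.v (Polynomial.aeval f p) = P.v f ^ p.natDegree := by
  have hlead : P.v (p.leadingCoeff • f ^ p.natDegree) = P.v f ^ p.natDegree := by
    rw [Algebra.smul_def, map_mul, map_pow, P.trivialOnBase _ (by simpa using hp), one_mul]
  rw [Polynomial.aeval_eq_sum_range, Finset.sum_range_succ, Polynomial.coeff_natDegree,
    Valuation.map_add_eq_of_lt_right, hlead]
  rw [hlead]
  refine Valuation.map_sum_lt _ (pow_ne_zero _ (zero_lt_one.trans hf).ne') fun i hi => ?_
  refine (P.v_smul_le _ _).trans_lt ?_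
  rw [map_pow]
  exact pow_lt_pow_right₀ hf (Finset.mem_range.mp hi)

theorem PlaceOf.v_add_inv_bound (P : PlaceOf k F) (f : F) {p : Polynomial k} (hp : p ≠ 0)
    (hg : Polynomial.aeval f p ≠ 0) :
    (max 1 (P.v f)) ^ (p.natDegree + 1) ≤
      max 1 (P.v (f + (Polynomial.aeval f p)⁻¹)) * P.v (Polynomial.aeval f p) := by
  rcases lt_or_ge 1 (P.v f) with h | h
  · have hle : 1 ≤ P.v f ^ p.natDegree := one_le_pow₀ h.le
    have hw : P.v (f + (Polynomial.aeval f p)⁻¹) = P.v f := by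
      refine Valuation.map_add_eq_of_lt_left _ ?_
      rw [map_inv₀, P.v_aeval_eq_of_one_lt h hp]
      exact (inv_le_one_of_one_le₀ hle).trans_lt h
    rw [hw, max_eq_right h.le, P.v_aeval_eq_of_one_lt h hp, pow_succ']
  · rw [max_eq_left h, one_pow]
    have hg1 : P.v (Polynomial.aeval f p) ≤ 1 :=
      (P.v_aeval_le f le_rfl).trans (by rw [max_eq_left h, one_pow])
    rcases hg1.lt_or_eq with h1 | h1
    · have h0 : 0 < P.v (Polynomial.aeval f p) := zero_lt_iff.mpr ((Valuation.ne_zero_iff _).mpr hg)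
      have hw : P.v (f + (Polynomial.aeval f p)⁻¹) = (P.v (Polynomial.aeval f p))⁻¹ := by
        rw [← map_inv₀ P.v]
        refine Valuation.map_add_eq_of_lt_right _ ?_
        rw [map_inv₀]
        exact h.trans_lt ((one_lt_inv₀ h0).mpr h1)
      rw [hw]
      calc (1 : WithZero (Multiplicative ℤ)) = _ := (inv_mul_cancel₀ h0.ne').symm
        _ ≤ _ := mul_le_mul' (le_max_right _ _) le_rfl
    · rw [h1, mul_one]
      exact le_max_left _ _

theorem PlaceOf.one_lt_v_add_inv (P : PlaceOf k F) (f : F) {p : Polynomial k} (hp : p ≠ 0)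
    (hg : Polynomial.aeval f p ≠ 0) (h : P.v f ≤ 1 → P.v (Polynomial.aeval f p) < 1) :
    1 < P.v (f + (Polynomial.aeval f p)⁻¹) := by
  have hb := P.v_add_inv_bound f hp hg
  by_contra! hle
  rw [max_eq_left hle, one_mul] at hb
  rcases lt_or_ge 1 (P.v f) with h1 | h1
  · rw [max_eq_right h1.le, P.v_aeval_eq_of_one_lt h1 hp] at hb
    exact absurd hb (not_le.mpr (pow_lt_pow_right₀ h1 (Nat.lt_succ_self _)))
  · rw [max_eq_left h1, one_pow] at hb
    exact absurd (h h1) (not_lt.mpr hb)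

theorem finrank_adjoin_le_of_aeval_eq_zero {K : Type} [Field K] [Algebra K F] {f : F}
    {Q : Polynomial K} (hQ : Q ≠ 0) (hf : Polynomial.aeval f Q = 0) :
    Module.finrank K K⟮f⟯ ≤ Q.natDegree := by
  have : IsIntegral K f := IsAlgebraic.isIntegral ⟨Q, hQ, hf⟩
  rw [adjoin.finrank this]
  exact Polynomial.natDegree_le_of_dvd (minpoly.dvd K f hf) hQ

theorem finrank_adjoin_add_inv_le {f : F} [FiniteDimensional k⟮f⟯ F] (hf : Transcendental k f)
    (p : Polynomial k) (hp : p ≠ 0) :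
    Module.finrank k⟮(f + (Polynomial.aeval f p)⁻¹)⁻¹⟯ F ≤
      (p.natDegree + 1) * Module.finrank k⟮f⟯ F := by
  have hg : Polynomial.aeval f p ≠ 0 := fun h => hf ⟨p, hp, h⟩
  set g := Polynomial.aeval f p with hgdef
  have hw0 : f * g + 1 ≠ 0 := by
    intro h
    have h1 : (Polynomial.X * p + 1 : Polynomial k) ≠ 0 := fun h => by
      have := congrArg (Polynomial.eval 0) h
      simp at this
    exact hf ⟨_, h1, by simpa using h⟩
  set u := (f + g⁻¹)⁻¹ with hu
  have hug : u * (f * g + 1) = g := by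
    rw [hu]
    have : f + g⁻¹ ≠ 0 := by
      intro h
      apply hw0
      have : (f + g⁻¹) * g = 0 := by rw [h, zero_mul]
      rwa [add_mul, inv_mul_cancel₀ hg] at this
    field_simp
  have hu0 : u ≠ 0 := by
    rintro h
    rw [h, zero_mul] at hug
    exact hg hug.symm
  let u' : k⟮u⟯ := ⟨u, mem_adjoin_simple_self k u⟩
  have hu0' : u' ≠ 0 := fun h => hu0 (congrArg Subtype.val h)
  let p' : Polynomial k⟮u⟯ := p.map (algebraMap k k⟮u⟯)
  have hp' : p'.natDegree = p.natDegree := Polynomial.natDegree_map _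
  let Q : Polynomial k⟮u⟯ := Polynomial.C u' * (Polynomial.X * p' + 1) - p'
  have hp0' : p' ≠ 0 := (Polynomial.map_ne_zero_iff (algebraMap k k⟮u⟯).injective).mpr hp
  have hQdeg : Q.natDegree ≤ p.natDegree + 1 := by
    rw [← hp']
    refine (Polynomial.natDegree_sub_le _ _).trans (max_le ?_ (Nat.le_succ _))
    refine (Polynomial.natDegree_C_mul_le _ _).trans ?_
    refine (Polynomial.natDegree_add_le _ _).trans (max_le ?_ (by simp))
    refine Polynomial.natDegree_mul_le.trans ?_
    simp [add_comm]
  have hQ0 : Q ≠ 0 := by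
    intro h
    have := congrArg (fun q => Polynomial.coeff q (p'.natDegree + 1)) h
    simp only [Q, Polynomial.coeff_sub, Polynomial.coeff_C_mul, Polynomial.coeff_add,
      Polynomial.coeff_X_mul, Polynomial.coeff_zero, Polynomial.coeff_natDegree,
      Polynomial.coeff_natDegree_succ_eq_zero, Polynomial.coeff_one] at this
    simp [hu0', hp0'] at this
  have hQf : Polynomial.aeval f Q = 0 := by
    have h1 : Polynomial.aeval f p' = g := Polynomial.aeval_map_algebraMap _ _ _
    have h2 : algebraMap k⟮u⟯ F u' = u := rfl
    simp only [Q, map_sub, map_mul, map_add, map_one, Polynomial.aeval_C, Polynomial.aeval_X, h1, h2]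
    rw [hug, sub_self]
  have h1 := finrank_adjoin_le_of_aeval_eq_zero hQ0 hQf
  have h2 := finrank_mul_finrank_restrictScalars (k := k) (F := F) k⟮u⟯⟮f⟯
  rw [← h2]
  refine Nat.mul_le_mul (h1.trans hQdeg) ?_
  have h3 := finrank_mul_finrank_of_simple_le (restrictScalars k k⟮u⟯⟮f⟯)
    (u := f) (mem_adjoin_simple_self k⟮u⟯ f)
  have h4 : 0 < Module.finrank k⟮f⟯ F := Module.finrank_pos
  exact Nat.le_of_dvd h4 (Dvd.intro_left _ h3)

end Riemann

section RiemannInequality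

variable {k F : Type} [Field k] [Field F] [Algebra k F]

theorem linearIndependent_pow_mul {f : F} (hf : Transcendental k f) {ι : Type} [Fintype ι]
    {y : ι → F} (hy : LinearIndependent k⟮f⟯ y) (m : ι → ℕ) :
    LinearIndependent k (fun a : Σ s, Fin (m s) => f ^ (a.2 : ℕ) * y a.1) := by
  rw [Fintype.linearIndependent_iff]
  intro c hc
  have h1 := (linearIndependent_adjoin_simple_iff f y).mp hy
    (fun s => ∑ i : Fin (m s), Polynomial.monomial (i : ℕ) (c ⟨s, i⟩)) (by
      rw [← hc, Fintype.sum_sigma]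
      refine Finset.sum_congr rfl fun s _ => ?_
      rw [map_sum, Finset.sum_mul]
      refine Finset.sum_congr rfl fun i _ => ?_
      rw [Polynomial.aeval_monomial, Algebra.smul_def, mul_assoc])
  rintro ⟨s, i⟩
  have h2 : ∑ i : Fin (m s), Polynomial.monomial (i : ℕ) (c ⟨s, i⟩) = 0 := by
    by_contra h
    exact hf ⟨_, h, h1 s⟩
  have := congrArg (fun p => Polynomial.coeff p i) h2
  simpa [Polynomial.finsetSum_coeff, Polynomial.coeff_monomial, Fin.val_inj] using this

/-- Multiples of the polar divisor of `w` bound the degree from above. -/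
theorem exists_polar_divisor
    (hfin : ∀ u : F, Transcendental k u → FiniteDimensional k⟮u⟯ F) {w : F}
    (hw : Transcendental k w) (r : ℕ) : ∃ D : PlaceOf k F →₀ ℤ,
      (∀ P : PlaceOf k F, WithZero.exp (D P) = (max 1 (P.v w)) ^ r) ∧
      (∀ P : PlaceOf k F, 1 < P.v w → (r : ℤ) ≤ D P) ∧ (∀ P, 0 ≤ D P) ∧
      DivisorOf.deg k F D ≤ r * Module.finrank k⟮w⁻¹⟯ F := by
  classical
  have hw' : Transcendental k w⁻¹ := fun h => hw (inv_inv w ▸ h.inv)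
  have hw0 : w ≠ 0 := fun h => hw (h ▸ isAlgebraic_zero)
  have := hfin _ hw'
  have hS := finite_setOf_one_lt hw
  have hex (P : PlaceOf k F) : ∃ m : ℕ, max 1 (P.v w) = WithZero.exp (m : ℤ) ∧
      (m ≠ 0 → 1 < P.v w) ∧ (1 < P.v w → 0 < m ∧ P.v w⁻¹ = WithZero.exp (-(m : ℤ))) := by
    obtain ⟨m, hm⟩ := P.exists_v_eq_exp hw0
    rcases lt_or_ge 1 (P.v w) with h | h
    · have h' := h
      rw [hm, ← WithZero.exp_zero, WithZero.exp_lt_exp] at h'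
      refine ⟨m.toNat, ?_, fun _ => h, fun _ => ⟨by omega, ?_⟩⟩
      · rw [max_eq_right h.le, hm, Int.toNat_of_nonneg h'.le]
      · rw [map_inv₀, hm, Int.toNat_of_nonneg h'.le, WithZero.exp_neg]
    · exact ⟨0, by simp [max_eq_left h], fun h => absurd rfl h, fun h' => absurd h' (not_lt.mpr h)⟩
  choose e he he0 he1 using hex
  have hfinD : (Function.support fun P => (r : ℤ) * (e P : ℤ)).Finite := by
    refine hS.subset fun P hP => he0 P fun h => hP ?_
    simp [h]
  let D : PlaceOf k F →₀ ℤ := Finsupp.ofSupportFinite _ hfinD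
  have hD (P) : D P = r * e P := rfl
  refine ⟨D, fun P => ?_, fun P hP => ?_, fun P => ?_, ?_⟩
  · rw [he, ← WithZero.exp_nsmul, hD, nsmul_eq_mul]
  · rw [hD]
    have := (he1 P hP).1
    nlinarith
  · rw [hD]
    positivity
  · have hsum := sum_mul_degree_le_finrank hw' hS.toFinset e fun P hP => he1 P (by simpa using hP)
    have hdeg : DivisorOf.deg k F D = r * ∑ P ∈ hS.toFinset, (e P : ℤ) * P.degree := by
      rw [DivisorOf.deg, Finsupp.sum_of_support_subset (s := hS.toFinset), Finset.mul_sum]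
      · exact Finset.sum_congr rfl fun P _ => by rw [hD, mul_assoc]
      · intro P hP
        have : (r : ℤ) * e P ≠ 0 := (hD P) ▸ Finsupp.mem_support_iff.mp hP
        simpa using he0 P fun h => this (by simp [h])
      · simp
    rw [hdeg]
    exact mul_le_mul_of_nonneg_left (by exact_mod_cast hsum) (by positivity)

theorem deg_sub_ell_le
    (hfin : ∀ u : F, Transcendental k u → FiniteDimensional k⟮u⟯ F) {f : F}
    (hf : Transcendental k f) {ι : Type} [Fintype ι] {y : ι → F} (hy : LinearIndependent k⟮f⟯ y)
    (hcard : Fintype.card ι = Module.finrank k⟮f⟯ F) {N : ι → ℕ}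
    (hN : ∀ s (P : PlaceOf k F), P.v (y s) ≤ (max 1 (P.v f)) ^ N s) (D : PlaceOf k F →₀ ℤ) :
    DivisorOf.deg k F D - ell k F D ≤ ∑ s, (N s : ℤ) - Fintype.card ι := by
  classical
  have := hfin f hf
  obtain ⟨p, hp, hpD⟩ := exists_aeval_lt_one_of_finset hfin D.support f
  have hg : Polynomial.aeval f p ≠ 0 := fun h => hf ⟨p, hp, h⟩
  have hw : Transcendental k (f + (Polynomial.aeval f p)⁻¹) := by
    obtain ⟨P, hP⟩ := exists_place_one_lt hfin hf
    intro h
    exact absurd (P.one_lt_v_add_inv f hp hg fun h => absurd hP (not_lt.mpr h))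
      (not_lt.mpr (P.v_le_one_of_isAlgebraic h))
  set r : ℕ := ∑ P ∈ D.support, (D P).natAbs + ∑ s, N s with hr
  obtain ⟨D', hexp, hrD, h0D, hdeg⟩ := exists_polar_divisor hfin hw r
  have hle : D ≤ D' := by
    intro P
    by_cases hP : P ∈ D.support
    · refine le_trans ?_ (hrD P (P.one_lt_v_add_inv f hp hg (hpD P hP)))
      have := Finset.single_le_sum (f := fun P => (D P).natAbs) (fun _ _ => Nat.zero_le _) hP
      omega
    · rw [Finsupp.notMem_support_iff.mp hP]
      exact h0D P
  have hRR := ell_sub_deg_le_of_le hfin hle (finiteDimensional_RRSpace hfin hf D)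
  have hfd := hRR.1
  set e := p.natDegree + 1 with he
  set g := Polynomial.aeval f p with hgdef
  have hNr (s : ι) : N s ≤ r * e := by
    have := Finset.single_le_sum (f := N) (fun _ _ => Nat.zero_le _) (Finset.mem_univ s)
    exact (this.trans (Nat.le_add_left _ _)).trans (Nat.le_mul_of_pos_right r (Nat.succ_pos _))
  let m : ι → ℕ := fun s => r * e - N s + 1
  have hind := linearIndependent_pow_mul hf hy m
  have hgr : (g ^ r)⁻¹ ≠ 0 := inv_ne_zero (pow_ne_zero _ hg)
  have hind' := hind.map' (LinearMap.mulRight k (g ^ r)⁻¹)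
    (LinearMap.ker_eq_bot.mpr (mul_left_injective₀ hgr))
  have hmem (a : Σ s, Fin (m s)) : f ^ (a.2 : ℕ) * y a.1 * (g ^ r)⁻¹ ∈ RRSpace k F D' := by
    rw [mem_RRSpace]
    intro P
    rw [hexp P, map_mul, map_mul, map_pow, map_inv₀, map_pow]
    have hg0 : 0 < P.v g ^ r := pow_pos (zero_lt_iff.mpr ((Valuation.ne_zero_iff _).mpr hg)) r
    rw [← div_eq_mul_inv, div_le_iff₀ hg0]
    calc P.v f ^ (a.2 : ℕ) * P.v (y a.1)
        ≤ (max 1 (P.v f)) ^ (a.2 : ℕ) * (max 1 (P.v f)) ^ N a.1 :=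
          mul_le_mul' (pow_le_pow_left' (le_max_right _ _) _) (hN _ P)
      _ = (max 1 (P.v f)) ^ ((a.2 : ℕ) + N a.1) := (pow_add _ _ _).symm
      _ ≤ (max 1 (P.v f)) ^ (e * r) := pow_le_pow_right' (le_max_left _ _) (by
          have h1 := a.2.2
          have h2 := hNr a.1
          simp only [m] at h1
          rw [mul_comm e r]
          omega)
      _ = ((max 1 (P.v f)) ^ e) ^ r := pow_mul _ _ _
      _ ≤ (max 1 (P.v (f + g⁻¹)) * P.v g) ^ r := pow_le_pow_left' (P.v_add_inv_bound f hp hg) r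
      _ = _ := mul_pow _ _ _
  have hcod : LinearIndependent k
      (fun a : Σ s, Fin (m s) => (⟨f ^ (a.2 : ℕ) * y a.1 * (g ^ r)⁻¹, hmem a⟩ : RRSpace k F D')) :=
    LinearIndependent.of_comp (RRSpace k F D').subtype hind'
  have hell : ∑ s, m s ≤ ell k F D' := by
    have := hcod.fintype_card_le_finrank
    simpa [Fintype.card_sigma, ell] using this
  have hsum : ((∑ s, m s : ℕ) : ℤ) = Fintype.card ι * (r * e) - ∑ s, (N s : ℤ) + Fintype.card ι := by
    have h1 (s : ι) : ((m s : ℕ) : ℤ) = (r * e - N s) + 1 := by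
      have := hNr s
      simp only [m]
      push_cast [Nat.cast_sub this]
      ring
    push_cast
    simp only [h1, Finset.sum_add_distrib, Finset.sum_sub_distrib, Finset.sum_const,
      Finset.card_univ, nsmul_eq_mul, mul_one]
  have hdeg' : (DivisorOf.deg k F D') ≤ Fintype.card ι * (r * e) := by
    refine hdeg.trans ?_
    have h1 := finrank_adjoin_add_inv_le hf p hp
    rw [← hcard] at h1
    have h2 : ((Module.finrank k⟮(f + g⁻¹)⁻¹⟯ F : ℕ) : ℤ) ≤ (e : ℤ) * Fintype.card ι := by
      exact_mod_cast h1
    calc (r : ℤ) * Module.finrank k⟮(f + g⁻¹)⁻¹⟯ F ≤ r * (e * Fintype.card ι) :=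
          mul_le_mul_of_nonneg_left h2 (by positivity)
      _ = _ := by ring
  have h3 : ((∑ s, m s : ℕ) : ℤ) ≤ ell k F D' := by exact_mod_cast hell
  linarith [hRR.2]

theorem ell_zero_pos
    (hfin : ∀ u : F, Transcendental k u → FiniteDimensional k⟮u⟯ F) {f : F}
    (hf : Transcendental k f) : 0 < ell k F 0 := by
  have := finiteDimensional_RRSpace_zero hfin hf
  have hone : (1 : F) ∈ RRSpace k F 0 := mem_RRSpace_zero_of_isAlgebraic isAlgebraic_one
  have : Nontrivial (RRSpace k F 0) :=
    ⟨⟨⟨1, hone⟩, 0, fun h => one_ne_zero (congrArg Subtype.val h)⟩⟩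
  exact Module.finrank_pos

end RiemannInequality

/-- Let `C` be an irreducible algebraic curve over a perfect field `k`, let `j ≥ 1`,
and let `f₁, …, f_j ∈ k(C)` each have degree `n ≥ 1` (that is, `[k(C) : k(fᵢ)] = n`).
If `k(f₁, …, f_j) = k(C)`, then the genus of `C` satisfies `g(C) ≤ (n - 1)²`. -/
theorem genus_le_of_generated_by_degree_n (k F : Type) [Field k] [PerfectField k]
    [Field F] [Algebra k F] (hC : IsCurveField k F)
    (j : ℕ) (hj : 1 ≤ j) (n : ℕ) (hn : 1 ≤ n) (f : Fin j → F)
    (hdeg : ∀ i, RatFnDegree k F (f i) n)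
    (hgen : IntermediateField.adjoin k (Set.range f) = ⊤) :
    genus k F ≤ (n - 1) ^ 2 := by
  obtain ⟨hF, -, x, hx⟩ := hC
  let i₀ : Fin j := ⟨0, hj⟩
  have hfd := (hdeg i₀).1
  have hf : Transcendental k (f i₀) := by
    intro h
    have := isAlgebraic_adjoin_simple h.isIntegral
    have := Algebra.IsAlgebraic.trans k k⟮f i₀⟯ F
    exact hx (Algebra.IsAlgebraic.isAlgebraic x)
  have hfin (u : F) (hu : Transcendental k u) : FiniteDimensional k⟮u⟯ F :=
    finiteDimensional_adjoin_simple_of_transcendental hF (f i₀) hu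
  obtain ⟨E, hfE, -, ι, _, y, N, hcard, -, hy, hN, hsum⟩ := exists_hasBoundedBasis hfin hf f
    fun i => ⟨(hdeg i).1, (hdeg i).2.trans (hdeg i₀).2.symm⟩
  have hE : E = ⊤ := by
    rw [← top_le_iff, ← hgen, adjoin_le_iff]
    rintro _ ⟨i, rfl⟩
    exact hfE i
  subst hE
  have hfr : Module.finrank k⟮f i₀⟯ F = n := (hdeg i₀).2
  rw [IntermediateField.finrank_top, mul_one] at hcard
  have hd := ell_zero_pos hfin hf
  refine csSup_le' ?_
  rintro g ⟨D, hD⟩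
  have hR := deg_sub_ell_le hfin hf hy hcard hN D
  rw [hcard.trans hfr] at hR hsum
  have hsum' : ∑ s, (N s : ℤ) + ell k F 0 * n ≤ n * n := by exact_mod_cast hsum
  obtain ⟨a, rfl⟩ : ∃ a, n = a + 1 := ⟨n - 1, by omega⟩
  obtain ⟨b, hb⟩ : ∃ b, ell k F 0 = b + 1 := ⟨ell k F 0 - 1, by omega⟩
  rw [hb] at hsum' hD
  push_cast at *
  zify
  have hab : (0 : ℤ) ≤ a * b := by positivity
  nlinarith
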